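/- arXiv:math/0002207 — 3 statements merged into one kernel-verified Lean document; each statement's English description precedes it below -/
import Mathlib

section
/- (Example 2.1: a counterexample to the Shapiro–Shapiro conjecture for flag manifolds.) The set of pairs (E_2, E_3) of subspaces of ℂ^5 with dim E_2 = 2, dim E_3 = 3, E_2 ⊆ E_3, such that E_2 ∩ F_3(s) ≠ {0} for each s ∈ {−8, −2, 1, 4} and E_3 ∩ F_2(s) ≠ {0} for each s ∈ {−4, −1, 2, 8}, has exactly twelve elements, and none of these twelve flags is real: for no element are both E_2 and E_3 stable under coordinatewise complex conjugation. -/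
/-- The `j`-th coordinatewise derivative at `s` of the rational normal curve
`γ(s) = (1, s, s², s³, s⁴)` in `ℂ⁵`. -/
noncomputable def oscVec5 (j : ℕ) (s : ℂ) : Fin 5 → ℂ :=
  fun i => iteratedDeriv j (fun t : ℂ => t ^ (i : ℕ)) s

/-- The osculating subspace `F_k(s) = span{γ(s), γ'(s), …, γ^{(k-1)}(s)}`. -/
noncomputable def oscF5 (k : ℕ) (s : ℂ) : Submodule ℂ (Fin 5 → ℂ) :=
  Submodule.span ℂ (Set.range fun j : Fin k => oscVec5 j s)

/-- A subspace of `ℂ⁵` is real if it is stable under coordinatewise complex conjugation. -/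
def conjStable5 (H : Submodule ℂ (Fin 5 → ℂ)) : Prop :=
  ∀ x ∈ H, (fun i => (starRingEnd ℂ) (x i)) ∈ H

/-- Linear forms cutting out the osculating subspace `F₃(s)`. -/
def osc3Form (s : ℂ) : Matrix (Fin 2) (Fin 5) ℂ :=
  !![-s ^ 3, 3 * s ^ 2, -3 * s, 1, 0; 0, -s ^ 3, 3 * s ^ 2, -3 * s, 1]

/-- Linear forms cutting out the osculating subspace `F₂(s)`. -/
def osc2Form (s : ℂ) : Matrix (Fin 3) (Fin 5) ℂ :=
  !![s ^ 2, -2 * s, 1, 0, 0; 0, s ^ 2, -2 * s, 1, 0; 0, 0, s ^ 2, -2 * s, 1]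

lemma oscVec5_apply (j : ℕ) (s : ℂ) (i : Fin 5) :
    oscVec5 j s i = (Nat.descFactorial i j : ℂ) * s ^ ((i : ℕ) - j) := by
  simp [oscVec5]

lemma osc3Form_mulVec (s : ℂ) (v : Fin 5 → ℂ) :
    (osc3Form s).mulVec v = ![-s ^ 3 * v 0 + 3 * s ^ 2 * v 1 - 3 * s * v 2 + v 3,
      -s ^ 3 * v 1 + 3 * s ^ 2 * v 2 - 3 * s * v 3 + v 4] := by
  ext i
  fin_cases i <;> simp [osc3Form, dotProduct, Fin.sum_univ_succ] <;> ring

lemma osc2Form_mulVec (s : ℂ) (v : Fin 5 → ℂ) :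
    (osc2Form s).mulVec v = ![s ^ 2 * v 0 - 2 * s * v 1 + v 2, s ^ 2 * v 1 - 2 * s * v 2 + v 3,
      s ^ 2 * v 2 - 2 * s * v 3 + v 4] := by
  ext i
  fin_cases i <;> simp [osc2Form, dotProduct, Fin.sum_univ_succ] <;> ring

lemma mem_oscF5_three (s : ℂ) (v : Fin 5 → ℂ) :
    v ∈ oscF5 3 s ↔ (osc3Form s).mulVec v = 0 := by
  rw [osc3Form_mulVec, oscF5, Submodule.mem_span_range_iff_exists_fun]
  simp only [Matrix.cons_eq_zero_iff, Matrix.zero_empty, and_true]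
  constructor
  · rintro ⟨c, rfl⟩
    simp only [Finset.sum_apply, Pi.smul_apply, smul_eq_mul, Fin.sum_univ_succ, oscVec5_apply]
    simp [Nat.descFactorial]
    constructor <;> ring
  · rintro ⟨h0, h1⟩
    refine ⟨![v 0, v 1 - s * v 0, (v 2 - 2 * s * v 1 + s ^ 2 * v 0) / 2], ?_⟩
    ext i
    simp only [Finset.sum_apply, Pi.smul_apply, smul_eq_mul, Fin.sum_univ_succ, oscVec5_apply]
    fin_cases i <;> simp [Nat.descFactorial]
    · ring
    · ring
    · linear_combination -h0
    · linear_combination -h1 - 3 * s * h0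

lemma mem_oscF5_two (s : ℂ) (v : Fin 5 → ℂ) :
    v ∈ oscF5 2 s ↔ (osc2Form s).mulVec v = 0 := by
  rw [osc2Form_mulVec, oscF5, Submodule.mem_span_range_iff_exists_fun]
  simp only [Matrix.cons_eq_zero_iff, Matrix.zero_empty, and_true]
  constructor
  · rintro ⟨c, rfl⟩
    simp only [Finset.sum_apply, Pi.smul_apply, smul_eq_mul, Fin.sum_univ_succ, oscVec5_apply]
    simp [Nat.descFactorial]
    refine ⟨?_, ?_, ?_⟩ <;> ring
  · rintro ⟨h0, h1, h2⟩
    refine ⟨![v 0, v 1 - s * v 0], ?_⟩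
    ext i
    simp only [Finset.sum_apply, Pi.smul_apply, smul_eq_mul, Fin.sum_univ_succ, oscVec5_apply]
    fin_cases i <;> simp [Nat.descFactorial]
    · ring
    · linear_combination -h0
    · linear_combination -h1 - 2 * s * h0
    · linear_combination -h2 - 2 * s * h1 - 3 * s ^ 2 * h0

lemma span_inf_ne_bot_iff {n : ℕ} {r : Fin n → Fin 5 → ℂ} (hr : LinearIndependent ℂ r)
    {L : Matrix (Fin n) (Fin 5) ℂ} {F : Submodule ℂ (Fin 5 → ℂ)}
    (hF : ∀ v, v ∈ F ↔ L.mulVec v = 0) :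
    Submodule.span ℂ (Set.range r) ⊓ F ≠ ⊥ ↔
      (Matrix.of fun i j => L.mulVec (r j) i).det = 0 := by
  have hmul (c : Fin n → ℂ) :
      (Matrix.of fun i j => L.mulVec (r j) i).mulVec c = L.mulVec (∑ i, c i • r i) := by
    rw [Matrix.mulVec_sum]
    ext k
    simp [Matrix.mulVec_smul, Matrix.mulVec, dotProduct, mul_comm]
  rw [← Matrix.exists_mulVec_eq_zero_iff, Submodule.ne_bot_iff]
  constructor
  · rintro ⟨v, hv, hv0⟩
    obtain ⟨c, rfl⟩ := (Submodule.mem_span_range_iff_exists_fun ℂ).1 hv.1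
    refine ⟨c, ?_, by rw [hmul]; exact (hF _).1 hv.2⟩
    rintro rfl
    simp at hv0
  · rintro ⟨c, hc, h⟩
    refine ⟨∑ i, c i • r i, ⟨(Submodule.mem_span_range_iff_exists_fun ℂ).2 ⟨c, rfl⟩,
      (hF _).2 (by rw [← hmul, h])⟩, fun h0 => hc ?_⟩
    exact funext (Fintype.linearIndependent_iff.1 hr c h0)

/-- Coordinates on `ℂ⁵` adapted to the eigenspaces of the involution induced by `s ↦ -8 / s`:
the first three are even, the last two odd. -/
def eigVec (p q r x y : ℂ) : Fin 5 → ℂ :=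
  ![p + x, q + y, r, 8 * (y - q), 64 * (p - x)]

lemma exists_eigVec (v : Fin 5 → ℂ) : ∃ p q r x y, v = eigVec p q r x y := by
  refine ⟨(v 0 + v 4 / 64) / 2, (v 1 - v 3 / 8) / 2, v 2, (v 0 - v 4 / 64) / 2,
    (v 1 + v 3 / 8) / 2, ?_⟩
  ext i
  fin_cases i <;> simp [eigVec] <;> ring

lemma eigVec_inj {p q r x y p' q' r' x' y' : ℂ} :
    eigVec p q r x y = eigVec p' q' r' x' y' ↔
      p = p' ∧ q = q' ∧ r = r' ∧ x = x' ∧ y = y' := by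
  refine ⟨fun h => ?_, by rintro ⟨rfl, rfl, rfl, rfl, rfl⟩; rfl⟩
  have h0 : p + x = p' + x' := congrFun h 0
  have h1 : q + y = q' + y' := congrFun h 1
  have h2 : r = r' := congrFun h 2
  have h3 : 8 * (y - q) = 8 * (y' - q') := congrFun h 3
  have h4 : 64 * (p - x) = 64 * (p' - x') := congrFun h 4
  refine ⟨?_, ?_, h2, ?_, ?_⟩
  · linear_combination h0 / 2 + h4 / 128
  · linear_combination h1 / 2 - h3 / 16
  · linear_combination h0 / 2 - h4 / 128
  · linear_combination h1 / 2 + h3 / 16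

lemma eigVec_zero : eigVec 0 0 0 0 0 = 0 := by
  ext i; fin_cases i <;> simp [eigVec]

lemma eigVec_eq_zero {p q r x y : ℂ} :
    eigVec p q r x y = 0 ↔ p = 0 ∧ q = 0 ∧ r = 0 ∧ x = 0 ∧ y = 0 := by
  rw [← eigVec_zero, eigVec_inj]

lemma eigVec_add (p q r x y p' q' r' x' y' : ℂ) :
    eigVec p q r x y + eigVec p' q' r' x' y' =
      eigVec (p + p') (q + q') (r + r') (x + x') (y + y') := by
  ext i; fin_cases i <;> simp [eigVec] <;> ring

lemma smul_eigVec (c p q r x y : ℂ) :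
    c • eigVec p q r x y = eigVec (c * p) (c * q) (c * r) (c * x) (c * y) := by
  ext i; fin_cases i <;> simp [eigVec] <;> ring

lemma conj_eigVec (p q r x y : ℂ) :
    (fun i => (starRingEnd ℂ) (eigVec p q r x y i)) =
      eigVec (starRingEnd ℂ p) (starRingEnd ℂ q) (starRingEnd ℂ r) (starRingEnd ℂ x)
        (starRingEnd ℂ y) := by
  ext i
  fin_cases i <;> simp [eigVec, Complex.conj_ofNat]

/-- The Schubert conditions on a plane with basis `eigVec a₁ a₂ a₃ x₀ y₀`,
`eigVec c₁ c₂ c₃ x₁ y₁`. -/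
lemma schubert_two_iff {a₁ a₂ a₃ x₀ y₀ c₁ c₂ c₃ x₁ y₁ : ℂ}
    (h : LinearIndependent ℂ ![eigVec a₁ a₂ a₃ x₀ y₀, eigVec c₁ c₂ c₃ x₁ y₁]) :
    (∀ s ∈ ({-8, -2, 1, 4} : Set ℂ),
      Submodule.span ℂ (Set.range ![eigVec a₁ a₂ a₃ x₀ y₀, eigVec c₁ c₂ c₃ x₁ y₁]) ⊓ oscF5 3 s ≠ ⊥)
        ↔
    (11 * (a₁ * c₂ - a₂ * c₁) + 7 * (a₁ * c₃ - a₃ * c₁) + 2 * (a₂ * c₃ - a₃ * c₂)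
        + 27 * (x₀ * y₁ - x₁ * y₀) = 0 ∧
      2 * (a₁ * c₂ - a₂ * c₁) + (a₁ * c₃ - a₃ * c₁) - (a₂ * c₃ - a₃ * c₂)
        - 6 * (x₀ * y₁ - x₁ * y₀) = 0) ∧
    (29 * (a₁ * y₁ - c₁ * y₀) - 13 * (a₂ * x₁ - c₂ * x₀) - 2 * (a₃ * y₁ - c₃ * y₀)
        - 5 * (a₃ * x₁ - c₃ * x₀) = 0 ∧
      -26 * (a₁ * y₁ - c₁ * y₀) - 32 * (a₁ * x₁ - c₁ * x₀) + 2 * (a₂ * x₁ - c₂ * x₀)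
        + 32 * (a₂ * y₁ - c₂ * y₀) - 15 * (a₃ * x₁ - c₃ * x₀) + 3 * (a₃ * y₁ - c₃ * y₀) = 0) := by
  simp only [span_inf_ne_bot_iff h (mem_oscF5_three _), Set.mem_insert_iff,
    Set.mem_singleton_iff, forall_eq_or_imp, forall_eq]
  simp [Matrix.det_fin_two, osc3Form_mulVec, eigVec]
  constructor
  · rintro ⟨h1, h2, h3, h4⟩
    refine ⟨⟨?_, ?_⟩, ?_, ?_⟩
    · linear_combination h1 / 27648 + h3 / 54
    · linear_combination -h2 / 576 - h4 / 4608
    · linear_combination h1 / 27648 - h2 / 432 - h3 / 54 + h4 / 3456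
    · linear_combination h2 / 64 - h4 / 512
  · rintro ⟨⟨h1, h2⟩, h3, h4⟩
    refine ⟨?_, ?_, ?_, ?_⟩
    · linear_combination 13824 * h1 + 13824 * h3 + 2048 * h4
    · linear_combination -288 * h2 + 32 * h4
    · linear_combination 27 * h1 - 27 * h3 - 4 * h4
    · linear_combination -2304 * h2 - 256 * h4

/-- The `3 × 3` determinant with columns `u`, `v`, `w`. -/
def detCols (u v w : Fin 3 → ℂ) : ℂ :=
  u 0 * (v 1 * w 2 - v 2 * w 1) - u 1 * (v 0 * w 2 - v 2 * w 0) + u 2 * (v 0 * w 1 - v 1 * w 0)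

/-- The Schubert conditions on the span of the three vectors `eigVec (p i) (q i) (r i) (x i) (y
  i)`. -/
lemma schubert_three_iff {p q r x y : Fin 3 → ℂ}
    (h : LinearIndependent ℂ fun i => eigVec (p i) (q i) (r i) (x i) (y i)) :
    (∀ s ∈ ({-4, -1, 2, 8} : Set ℂ),
      Submodule.span ℂ (Set.range fun i => eigVec (p i) (q i) (r i) (x i) (y i)) ⊓ oscF5 2 s ≠ ⊥) ↔
    (9 * detCols p q r + 32 * detCols p x y - 16 * detCols q x y - 3 * detCols r x y = 0 ∧
      81 * detCols p q r + 128 * detCols p x y + 224 * detCols q x y + 33 * detCols r x y = 0) ∧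
    (32 * detCols p q x - 80 * detCols p q y + 32 * detCols p r x + detCols p r y
        - 13 * detCols q r x - 8 * detCols q r y = 0 ∧
      -896 * detCols p q x - 2080 * detCols p q y + 256 * detCols p r x - 343 * detCols p r y
        + 679 * detCols q r x - 64 * detCols q r y = 0) := by
  simp only [span_inf_ne_bot_iff h (mem_oscF5_two _), Set.mem_insert_iff,
    Set.mem_singleton_iff, forall_eq_or_imp, forall_eq]
  simp [Matrix.det_fin_three, osc2Form_mulVec, eigVec, detCols]
  constructor
  · rintro ⟨h1, h2, h3, h4⟩
    refine ⟨⟨?_, ?_⟩, ?_, ?_⟩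
    · linear_combination h1 / 3072 + h3 / 384
    · linear_combination h2 / 18 + h4 / 9216
    · linear_combination -h1 / 1024 + h3 / 128
    · linear_combination -h2 / 2 + h4 / 1024
  · rintro ⟨⟨h1, h2⟩, h3, h4⟩
    refine ⟨?_, ?_, ?_, ?_⟩
    · linear_combination 1536 * h1 - 512 * h3
    · linear_combination 9 * h2 - h4
    · linear_combination 192 * h1 + 64 * h3
    · linear_combination 4608 * h2 + 512 * h4

/-- The incidence conditions on a pair `(E₂, E₃)` of subspaces with `E₂ ⊆ E₃`. -/
def IsSchubertFlag (P : Submodule ℂ (Fin 5 → ℂ) × Submodule ℂ (Fin 5 → ℂ)) : Prop :=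
  Module.finrank ℂ P.1 = 2 ∧ Module.finrank ℂ P.2 = 3 ∧ P.1 ≤ P.2 ∧
    (∀ s ∈ ({-8, -2, 1, 4} : Set ℂ), P.1 ⊓ oscF5 3 s ≠ ⊥) ∧
    (∀ s ∈ ({-4, -1, 2, 8} : Set ℂ), P.2 ⊓ oscF5 2 s ≠ ⊥)

/-- The flag spanned by `u, v` and `u, v, w`. -/
def spanFlag (u v w : Fin 5 → ℂ) : Submodule ℂ (Fin 5 → ℂ) × Submodule ℂ (Fin 5 → ℂ) :=
  (Submodule.span ℂ (Set.range ![u, v]), Submodule.span ℂ (Set.range ![u, v, w]))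

lemma mem_span_range_two {u v z : Fin 5 → ℂ} :
    z ∈ Submodule.span ℂ (Set.range ![u, v]) ↔ ∃ s t : ℂ, z = s • u + t • v := by
  rw [Submodule.mem_span_range_iff_exists_fun]
  constructor
  · rintro ⟨c, rfl⟩
    exact ⟨c 0, c 1, by simp [Fin.sum_univ_two]⟩
  · rintro ⟨s, t, rfl⟩
    exact ⟨![s, t], by simp [Fin.sum_univ_two]⟩

lemma linearIndependent_three_iff {u v w : Fin 5 → ℂ} :
    LinearIndependent ℂ ![u, v, w] ↔
      ∀ s t r : ℂ, s • u + t • v + r • w = 0 → s = 0 ∧ t = 0 ∧ r = 0 := by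
  rw [Fintype.linearIndependent_iff]
  constructor
  · intro h s t r hr
    have := h ![s, t, r] (by simpa [Fin.sum_univ_three] using hr)
    exact ⟨this 0, this 1, this 2⟩
  · intro h c hc
    obtain ⟨h0, h1, h2⟩ := h (c 0) (c 1) (c 2) (by simpa [Fin.sum_univ_three] using hc)
    intro i
    fin_cases i <;> assumption

lemma linearIndependent_two_of_three {u v w : Fin 5 → ℂ} (h : LinearIndependent ℂ ![u, v, w]) :
    LinearIndependent ℂ ![u, v] := by
  rw [linearIndependent_three_iff] at h
  rw [LinearIndependent.pair_iff]
  intro s t hst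
  obtain ⟨h0, h1, -⟩ := h s t 0 (by simpa using hst)
  exact ⟨h0, h1⟩

lemma span_range_eq_of_mem {n : ℕ} {r : Fin n → Fin 5 → ℂ} (hr : LinearIndependent ℂ r)
    {E : Submodule ℂ (Fin 5 → ℂ)} (hE : Module.finrank ℂ E = n) (h : ∀ i, r i ∈ E) :
    E = Submodule.span ℂ (Set.range r) := by
  refine (Submodule.eq_of_le_of_finrank_eq ?_ ?_).symm
  · rw [Submodule.span_le]
    rintro _ ⟨i, rfl⟩
    exact h i
  · rw [hE, finrank_span_eq_card hr, Fintype.card_fin]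

lemma eq_spanFlag {P : Submodule ℂ (Fin 5 → ℂ) × Submodule ℂ (Fin 5 → ℂ)}
    (hP : IsSchubertFlag P) {u v w : Fin 5 → ℂ} (hu : u ∈ P.1) (hv : v ∈ P.1) (hw : w ∈ P.2)
    (h : LinearIndependent ℂ ![u, v, w]) : P = spanFlag u v w := by
  obtain ⟨h2, h3, hle, -⟩ := hP
  refine Prod.ext (span_range_eq_of_mem (linearIndependent_two_of_three h) h2 ?_)
    (span_range_eq_of_mem h h3 ?_)
  · intro i
    fin_cases i <;> assumption
  · intro i
    fin_cases i
    exacts [hle hu, hle hv, hw]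

lemma exists_mem_linearIndependent_two {E : Submodule ℂ (Fin 5 → ℂ)} (hE : Module.finrank ℂ E = 2)
    {u : Fin 5 → ℂ} (hu : u ≠ 0) : ∃ v ∈ E, LinearIndependent ℂ ![u, v] := by
  by_contra! H
  have hle : E ≤ Submodule.span ℂ {u} := by
    intro v hv
    have := H v hv
    rw [LinearIndependent.pair_iff' hu] at this
    push Not at this
    obtain ⟨a, rfl⟩ := this
    exact Submodule.smul_mem _ _ (Submodule.mem_span_singleton_self u)
  have := Submodule.finrank_mono hle
  rw [hE, finrank_span_singleton hu] at this
  omega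

lemma exists_mem_linearIndependent_three {E : Submodule ℂ (Fin 5 → ℂ)}
    (hE : Module.finrank ℂ E = 3) {u v : Fin 5 → ℂ} (h : LinearIndependent ℂ ![u, v]) :
    ∃ w ∈ E, LinearIndependent ℂ ![u, v, w] := by
  have hlt : ¬ E ≤ Submodule.span ℂ (Set.range ![u, v]) := by
    intro hle
    have := Submodule.finrank_mono hle
    rw [hE, finrank_span_eq_card h] at this
    simp at this
  obtain ⟨w, hw, hw'⟩ := SetLike.not_le_iff_exists.1 hlt
  refine ⟨w, hw, linearIndependent_three_iff.2 fun s t r hr => ?_⟩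
  have h0 : r = 0 := by
    by_contra h0
    refine hw' (mem_span_range_two.2 ⟨-(r⁻¹ * s), -(r⁻¹ * t), ?_⟩)
    have : w = r⁻¹ • (s • u + t • v + r • w) - r⁻¹ • (s • u) - r⁻¹ • (t • v) := by
      rw [smul_add, smul_add, inv_smul_smul₀ h0]
      abel
    rw [hr] at this
    rw [this]
    simp [mul_smul, sub_eq_add_neg]
  subst h0
  rw [LinearIndependent.pair_iff] at h
  obtain ⟨hs, ht⟩ := h s t (by simpa using hr)
  exact ⟨hs, ht, rfl⟩

lemma isSchubertFlag_spanFlag_iff {a₁ a₂ a₃ x₀ y₀ c₁ c₂ c₃ x₁ y₁ e₁ e₂ e₃ x₂ y₂ : ℂ}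
    (h : LinearIndependent ℂ
      ![eigVec a₁ a₂ a₃ x₀ y₀, eigVec c₁ c₂ c₃ x₁ y₁, eigVec e₁ e₂ e₃ x₂ y₂]) :
    IsSchubertFlag (spanFlag (eigVec a₁ a₂ a₃ x₀ y₀) (eigVec c₁ c₂ c₃ x₁ y₁)
      (eigVec e₁ e₂ e₃ x₂ y₂)) ↔
    ((11 * (a₁ * c₂ - a₂ * c₁) + 7 * (a₁ * c₃ - a₃ * c₁) + 2 * (a₂ * c₃ - a₃ * c₂)
        + 27 * (x₀ * y₁ - x₁ * y₀) = 0 ∧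
      2 * (a₁ * c₂ - a₂ * c₁) + (a₁ * c₃ - a₃ * c₁) - (a₂ * c₃ - a₃ * c₂)
        - 6 * (x₀ * y₁ - x₁ * y₀) = 0) ∧
    (29 * (a₁ * y₁ - c₁ * y₀) - 13 * (a₂ * x₁ - c₂ * x₀) - 2 * (a₃ * y₁ - c₃ * y₀)
        - 5 * (a₃ * x₁ - c₃ * x₀) = 0 ∧
      -26 * (a₁ * y₁ - c₁ * y₀) - 32 * (a₁ * x₁ - c₁ * x₀) + 2 * (a₂ * x₁ - c₂ * x₀)
        + 32 * (a₂ * y₁ - c₂ * y₀) - 15 * (a₃ * x₁ - c₃ * x₀) + 3 * (a₃ * y₁ - c₃ * y₀) = 0)) ∧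
    ((9 * detCols ![a₁, c₁, e₁] ![a₂, c₂, e₂] ![a₃, c₃, e₃]
        + 32 * detCols ![a₁, c₁, e₁] ![x₀, x₁, x₂] ![y₀, y₁, y₂]
        - 16 * detCols ![a₂, c₂, e₂] ![x₀, x₁, x₂] ![y₀, y₁, y₂]
        - 3 * detCols ![a₃, c₃, e₃] ![x₀, x₁, x₂] ![y₀, y₁, y₂] = 0 ∧
      81 * detCols ![a₁, c₁, e₁] ![a₂, c₂, e₂] ![a₃, c₃, e₃]
        + 128 * detCols ![a₁, c₁, e₁] ![x₀, x₁, x₂] ![y₀, y₁, y₂]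
        + 224 * detCols ![a₂, c₂, e₂] ![x₀, x₁, x₂] ![y₀, y₁, y₂]
        + 33 * detCols ![a₃, c₃, e₃] ![x₀, x₁, x₂] ![y₀, y₁, y₂] = 0) ∧
    (32 * detCols ![a₁, c₁, e₁] ![a₂, c₂, e₂] ![x₀, x₁, x₂]
        - 80 * detCols ![a₁, c₁, e₁] ![a₂, c₂, e₂] ![y₀, y₁, y₂]
        + 32 * detCols ![a₁, c₁, e₁] ![a₃, c₃, e₃] ![x₀, x₁, x₂]
        + detCols ![a₁, c₁, e₁] ![a₃, c₃, e₃] ![y₀, y₁, y₂]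
        - 13 * detCols ![a₂, c₂, e₂] ![a₃, c₃, e₃] ![x₀, x₁, x₂]
        - 8 * detCols ![a₂, c₂, e₂] ![a₃, c₃, e₃] ![y₀, y₁, y₂] = 0 ∧
      -896 * detCols ![a₁, c₁, e₁] ![a₂, c₂, e₂] ![x₀, x₁, x₂]
        - 2080 * detCols ![a₁, c₁, e₁] ![a₂, c₂, e₂] ![y₀, y₁, y₂]
        + 256 * detCols ![a₁, c₁, e₁] ![a₃, c₃, e₃] ![x₀, x₁, x₂]
        - 343 * detCols ![a₁, c₁, e₁] ![a₃, c₃, e₃] ![y₀, y₁, y₂]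
        + 679 * detCols ![a₂, c₂, e₂] ![a₃, c₃, e₃] ![x₀, x₁, x₂]
        - 64 * detCols ![a₂, c₂, e₂] ![a₃, c₃, e₃] ![y₀, y₁, y₂] = 0)) := by
  have h2 := linearIndependent_two_of_three h
  have hfun : (fun i => eigVec (![a₁, c₁, e₁] i) (![a₂, c₂, e₂] i) (![a₃, c₃, e₃] i)
      (![x₀, x₁, x₂] i) (![y₀, y₁, y₂] i)) =
      ![eigVec a₁ a₂ a₃ x₀ y₀, eigVec c₁ c₂ c₃ x₁ y₁, eigVec e₁ e₂ e₃ x₂ y₂] := by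
    funext i
    fin_cases i <;> rfl
  have h3 := schubert_three_iff (p := ![a₁, c₁, e₁]) (q := ![a₂, c₂, e₂]) (r := ![a₃, c₃, e₃])
    (x := ![x₀, x₁, x₂]) (y := ![y₀, y₁, y₂]) (by rw [hfun]; exact h)
  rw [hfun] at h3
  rw [← schubert_two_iff h2, ← h3, IsSchubertFlag, spanFlag]
  refine ⟨fun H => H.2.2.2, fun H => ⟨?_, ?_, ?_, H⟩⟩
  · rw [finrank_span_eq_card h2, Fintype.card_fin]
  · rw [finrank_span_eq_card h, Fintype.card_fin]
  · refine Submodule.span_mono ?_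
    rintro _ ⟨i, rfl⟩
    fin_cases i
    exacts [⟨0, rfl⟩, ⟨1, rfl⟩]

lemma exists_smul_of_cross_eq_zero {a₁ a₂ a₃ b₁ b₂ b₃ : ℂ} (ha : ¬ (a₁ = 0 ∧ a₂ = 0 ∧ a₃ = 0))
    (h₁ : a₂ * b₃ - a₃ * b₂ = 0) (h₂ : a₁ * b₃ - a₃ * b₁ = 0) (h₃ : a₁ * b₂ - a₂ * b₁ = 0) :
    ∃ c, b₁ = c * a₁ ∧ b₂ = c * a₂ ∧ b₃ = c * a₃ := by
  by_cases h1 : a₁ = 0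
  · by_cases h2 : a₂ = 0
    · have h3 : a₃ ≠ 0 := fun h3 => ha ⟨h1, h2, h3⟩
      refine ⟨b₃ / a₃, ?_, ?_, ?_⟩ <;> field_simp
      · linear_combination -h₂
      · linear_combination -h₁
    · refine ⟨b₂ / a₂, ?_, ?_, ?_⟩ <;> field_simp
      · linear_combination -h₃
      · linear_combination h₁
  · refine ⟨b₁ / a₁, ?_, ?_, ?_⟩ <;> field_simp
    · linear_combination h₃
    · linear_combination h₂

/-- If `E₂` contains a nonzero even vector, then both subspaces are spanned by even and odd
vectors. -/
lemma exists_eq_spanFlag_of_even_mem {P : Submodule ℂ (Fin 5 → ℂ) × Submodule ℂ (Fin 5 → ℂ)}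
    (hP : IsSchubertFlag P) {a₁ a₂ a₃ : ℂ} (ha : eigVec a₁ a₂ a₃ 0 0 ∈ P.1)
    (ha0 : eigVec a₁ a₂ a₃ 0 0 ≠ 0) :
    ∃ x y e₁ e₂ e₃, P = spanFlag (eigVec a₁ a₂ a₃ 0 0) (eigVec 0 0 0 x y) (eigVec e₁ e₂ e₃ 0 0) ∧
      LinearIndependent ℂ ![eigVec a₁ a₂ a₃ 0 0, eigVec 0 0 0 x y, eigVec e₁ e₂ e₃ 0 0] := by
  obtain ⟨b, hb, hab⟩ := exists_mem_linearIndependent_two hP.1 ha0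
  obtain ⟨w, hw, habw⟩ := exists_mem_linearIndependent_three hP.2.1 hab
  obtain ⟨c₁, c₂, c₃, x, y, rfl⟩ := exists_eigVec b
  obtain ⟨e₁, e₂, e₃, x', y', rfl⟩ := exists_eigVec w
  have hane : ¬ (a₁ = 0 ∧ a₂ = 0 ∧ a₃ = 0) := by simpa [eigVec_eq_zero] using ha0
  have hP0 := hP
  have hPe := eq_spanFlag hP ha hb hw habw
  rw [hPe, isSchubertFlag_spanFlag_iff habw] at hP0
  obtain ⟨⟨⟨h1, h2⟩, h3, h4⟩, ⟨h5, h6⟩, h7, h8⟩ := hP0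
  simp only [detCols, Matrix.cons_val_zero, Matrix.cons_val_one, Matrix.cons_val] at h5 h6 h7 h8
  have hZ : a₁ * c₂ - a₂ * c₁ = 3 * (a₂ * c₃ - a₃ * c₂) := by
    linear_combination 7 / 3 * h2 - h1 / 3
  have hY : a₁ * c₃ - a₃ * c₁ = -5 * (a₂ * c₃ - a₃ * c₂) := by
    linear_combination h2 - 2 * hZ
  have hXaux : (a₂ * c₃ - a₃ * c₂) * (a₁ + 5 * a₂ + 3 * a₃) = 0 := by
    linear_combination a₂ * hY - a₃ * hZ
  have hpar : a₂ * c₃ - a₃ * c₂ = 0 → ∃ l, c₁ = l * a₁ ∧ c₂ = l * a₂ ∧ c₃ = l * a₃ := fun hX =>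
    exists_smul_of_cross_eq_zero hane hX (by rw [hY, hX, mul_zero]) (by rw [hZ, hX, mul_zero])
  have hsing : x * ((13 * a₂ + 5 * a₃) * (26 * a₁ - 32 * a₂ - 3 * a₃)
        + (29 * a₁ - 2 * a₃) * (32 * a₁ - 2 * a₂ + 15 * a₃)) = 0 ∧
      y * ((13 * a₂ + 5 * a₃) * (26 * a₁ - 32 * a₂ - 3 * a₃)
        + (29 * a₁ - 2 * a₃) * (32 * a₁ - 2 * a₂ + 15 * a₃)) = 0 := by
    constructor
    · linear_combination (-26 * a₁ + 32 * a₂ + 3 * a₃) * h3 - (29 * a₁ - 2 * a₃) * h4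
    · linear_combination (32 * a₁ - 2 * a₂ + 15 * a₃) * h3 - (13 * a₂ + 5 * a₃) * h4
  by_cases hd : x = 0 ∧ y = 0
  · exfalso
    obtain ⟨rfl, rfl⟩ := hd
    by_cases hX : a₂ * c₃ - a₃ * c₂ = 0
    · obtain ⟨l, rfl, rfl, rfl⟩ := hpar hX
      have := linearIndependent_three_iff.1 habw l (-1) 0
        (by simp only [smul_eigVec, eigVec_add, eigVec_eq_zero]; refine ⟨?_, ?_, ?_, ?_, ?_⟩ <;>
          ring)
      simp at this
    · have hx' : x' = 0 := by
        refine (mul_eq_zero.1 (?_ : (a₂ * c₃ - a₃ * c₂) * x' = 0)).resolve_left hX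
        linear_combination (4589 / 11 * (h7 - (32 * x' - 80 * y') * hZ - (32 * x' + y') * hY)
          - 23 * (h8 - (-896 * x' - 2080 * y') * hZ - (256 * x' - 343 * y') * hY)) / 43524
      have hy' : y' = 0 := by
        refine (mul_eq_zero.1 (?_ : (a₂ * c₃ - a₃ * c₂) * y' = 0)).resolve_left hX
        linear_combination (7 * (h8 - (-896 * x' - 2080 * y') * hZ - (256 * x' - 343 * y') * hY)
          - 299 * (h7 - (32 * x' - 80 * y') * hZ - (32 * x' + y') * hY)) / 43524
      subst hx' hy'
      have := linearIndependent_three_iff.1 habw (e₂ * c₃ - e₃ * c₂) (a₂ * e₃ - a₃ * e₂)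
        (-(a₂ * c₃ - a₃ * c₂)) (by
          simp only [smul_eigVec, eigVec_add, eigVec_eq_zero]
          refine ⟨by linear_combination -h5 / 9, ?_, ?_, ?_, ?_⟩ <;> ring)
      exact hX (neg_eq_zero.1 this.2.2)
  by_cases hdd : x * y' - x' * y = 0
  · obtain ⟨l, hl1, hl2, -⟩ := exists_smul_of_cross_eq_zero (a₁ := x) (a₂ := y) (a₃ := 0)
      (b₁ := x') (b₂ := y') (b₃ := 0) (by tauto) (by ring) (by ring) (by linear_combination hdd)
    have he : eigVec (e₁ - l * c₁) (e₂ - l * c₂) (e₃ - l * c₃) 0 0 =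
        eigVec e₁ e₂ e₃ x' y' + (-l) • eigVec c₁ c₂ c₃ x y := by
      rw [smul_eigVec, eigVec_add, eigVec_inj]
      refine ⟨by ring, by ring, by ring, ?_, ?_⟩
      · linear_combination -hl1
      · linear_combination -hl2
    have hLI : LinearIndependent ℂ ![eigVec a₁ a₂ a₃ 0 0, eigVec c₁ c₂ c₃ x y,
        eigVec (e₁ - l * c₁) (e₂ - l * c₂) (e₃ - l * c₃) 0 0] := by
      rw [linearIndependent_three_iff] at habw ⊢
      intro s t r hr
      obtain ⟨k1, k2, k3⟩ := habw s (t - l * r) r (by rw [← hr, he]; module)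
      subst k3
      exact ⟨k1, by linear_combination k2, rfl⟩
    have hmem : eigVec (e₁ - l * c₁) (e₂ - l * c₂) (e₃ - l * c₃) 0 0 ∈ P.2 :=
      he ▸ P.2.add_mem hw (P.2.smul_mem _ (hP.2.2.1 hb))
    clear h5 h6 h7 h8 hPe
    generalize e₁ - l * c₁ = e₁, e₂ - l * c₂ = e₂, e₃ - l * c₃ = e₃ at hLI hmem
    have hPe := eq_spanFlag hP ha hb hmem hLI
    have hP0 := hP
    rw [hPe, isSchubertFlag_spanFlag_iff hLI] at hP0
    obtain ⟨-, ⟨h5, h6⟩, h7, h8⟩ := hP0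
    simp only [detCols, Matrix.cons_val_zero, Matrix.cons_val_one, Matrix.cons_val] at h5 h6 h7 h8
    by_cases hX : a₂ * c₃ - a₃ * c₂ = 0
    · obtain ⟨m, rfl, rfl, rfl⟩ := hpar hX
      have hb' : eigVec 0 0 0 x y =
          eigVec (m * a₁) (m * a₂) (m * a₃) x y + (-m) • eigVec a₁ a₂ a₃ 0 0 := by
        rw [smul_eigVec, eigVec_add, eigVec_inj]
        refine ⟨?_, ?_, ?_, ?_, ?_⟩ <;> ring
      have hLI' : LinearIndependent ℂ ![eigVec a₁ a₂ a₃ 0 0, eigVec 0 0 0 x y,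
          eigVec e₁ e₂ e₃ 0 0] := by
        rw [linearIndependent_three_iff] at hLI ⊢
        intro s t r hr
        obtain ⟨k1, k2, k3⟩ := hLI (s - m * t) t r (by rw [← hr, hb']; module)
        subst k2
        exact ⟨by linear_combination k1, rfl, k3⟩
      exact ⟨x, y, e₁, e₂, e₃, eq_spanFlag hP ha
        (hb' ▸ P.1.add_mem hb (P.1.smul_mem _ ha)) hmem hLI', hLI'⟩
    · exfalso
      have hZ' : a₁ * e₂ - a₂ * e₁ = 3 * (a₂ * e₃ - a₃ * e₂) := by
        refine sub_eq_zero.1 ((mul_eq_zero.1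
          (?_ : (a₂ * c₃ - a₃ * c₂) * _ = 0)).resolve_left hX)
        linear_combination (a₂ * e₃ - a₃ * e₂) * hZ - a₂ * h5 / 9
      have hY' : a₁ * e₃ - a₃ * e₁ = -5 * (a₂ * e₃ - a₃ * e₂) := by
        refine sub_eq_zero.1 ((mul_eq_zero.1
          (?_ : (a₂ * c₃ - a₃ * c₂) * _ = 0)).resolve_left hX)
        linear_combination (a₂ * e₃ - a₃ * e₂) * hY - a₃ * h5 / 9
      by_cases hX' : a₂ * e₃ - a₃ * e₂ = 0
      · obtain ⟨m, rfl, rfl, rfl⟩ := exists_smul_of_cross_eq_zero hane hX'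
          (by rw [hY', hX', mul_zero]) (by rw [hZ', hX', mul_zero])
        have := linearIndependent_three_iff.1 hLI m 0 (-1) (by
          simp only [smul_eigVec, eigVec_add, eigVec_eq_zero]
          refine ⟨?_, ?_, ?_, ?_, ?_⟩ <;> ring)
        simp at this
      · refine hd ⟨?_, ?_⟩
        · refine (mul_eq_zero.1 (?_ : (a₂ * e₃ - a₃ * e₂) * x = 0)).resolve_left hX'
          linear_combination (4589 / 11 * (-h7 - (32 * x - 80 * y) * hZ' - (32 * x + y) * hY')
            - 23 * (-h8 - (-896 * x - 2080 * y) * hZ' - (256 * x - 343 * y) * hY')) / 43524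
        · refine (mul_eq_zero.1 (?_ : (a₂ * e₃ - a₃ * e₂) * y = 0)).resolve_left hX'
          linear_combination (7 * (-h8 - (-896 * x - 2080 * y) * hZ' - (256 * x - 343 * y) * hY')
            - 299 * (-h7 - (32 * x - 80 * y) * hZ' - (32 * x + y) * hY')) / 43524
  · exfalso
    have hE : 40 * a₁ - 92 * a₂ - 15 * a₃ = 0 := by
      refine (mul_eq_zero.1 (?_ : (x * y' - x' * y) * _ = 0)).resolve_left hdd
      linear_combination (9 * h5 - h6) / 4
    have hMne : (13 * a₂ + 5 * a₃) * (26 * a₁ - 32 * a₂ - 3 * a₃)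
        + (29 * a₁ - 2 * a₃) * (32 * a₁ - 2 * a₂ + 15 * a₃) ≠ 0 := by
      by_cases hX : a₂ * c₃ - a₃ * c₂ = 0
      · obtain ⟨m, rfl, rfl, rfl⟩ := hpar hX
        have hE' : 32 * a₁ - 16 * a₂ - 3 * a₃ = 0 := by
          refine (mul_eq_zero.1 (?_ : (x * y' - x' * y) * _ = 0)).resolve_left hdd
          linear_combination h5
        obtain rfl : a₂ = -10 * a₁ := by linear_combination (5 * hE' - hE) / 12
        obtain rfl : a₃ = 64 * a₁ := by linear_combination -hE' / 3
        have h1 : a₁ ≠ 0 := by rintro rfl; simp at hane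
        exact fun h => h1 (pow_eq_zero_iff two_ne_zero |>.1 (by linear_combination -h / 70928))
      · have hE' := (mul_eq_zero.1 hXaux).resolve_left hX
        obtain rfl : a₁ = -5 * a₂ - 3 * a₃ := by linear_combination hE'
        obtain rfl : a₂ = -135 / 292 * a₃ := by linear_combination -hE / 292
        have h1 : a₃ ≠ 0 := by rintro rfl; simp at hane
        exact fun h => h1 (pow_eq_zero_iff two_ne_zero |>.1
          (by linear_combination 10658 / 1494207 * h))
    exact hd ⟨(mul_eq_zero.1 hsing.1).resolve_right hMne, (mul_eq_zero.1 hsing.2).resolve_right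
      hMne⟩

/-- The parameters of the flags for which `E₂` contains an even vector. -/
def evenQuartic (t : ℂ) : ℂ := 4352 * t ^ 4 + 5580 * t ^ 3 + 72149 * t ^ 2 + 2790 * t + 1088

/-- The candidate solutions for which `E₂` contains an even vector. -/
def evenFlag (t : ℂ) : Submodule ℂ (Fin 5 → ℂ) × Submodule ℂ (Fin 5 → ℂ) :=
  spanFlag (eigVec (-205 * t ^ 2 - 125 * t - 64) (-160 * t ^ 2 - 629 * t + 35)
      (416 * t ^ 2 + 280 * t - 928) 0 0)
    (eigVec 0 0 0 t 1)
    (eigVec (280 * t ^ 2 - 2516 * t - 320) (-(1024 * t ^ 2 + 1000 * t + 820)) 0 0 0)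

lemma linearIndependent_evenFlag {t : ℂ} (ht : evenQuartic t = 0) :
    LinearIndependent ℂ ![eigVec (-205 * t ^ 2 - 125 * t - 64)
      (-160 * t ^ 2 - 629 * t + 35) (416 * t ^ 2 + 280 * t - 928) 0 0,
      eigVec 0 0 0 t 1,
      eigVec (280 * t ^ 2 - 2516 * t - 320) (-(1024 * t ^ 2 + 1000 * t + 820)) 0 0 0] := by
  rw [evenQuartic] at ht
  rw [linearIndependent_three_iff]
  intro a b c habc
  simp only [smul_eigVec, eigVec_add, eigVec_eq_zero] at habc
  obtain ⟨h1, h2, h3, -, h5⟩ := habc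
  have ha : a = 0 := by
    linear_combination (-62514100 / 4390876613169 * t ^ 3 - 5259992711 / 70254025810704 * t ^ 2
      - 84944209865 / 281016103242816 * t - 150367125965 / 140508051621408) * h3
      + (11951225 / 8781753226338 * t + 222279119 / 35127012905352) * a * ht
  have hb : b = 0 := by linear_combination h5
  subst ha hb
  refine ⟨rfl, rfl, ?_⟩
  linear_combination (4408 / 7971615 * t + 11023 / 25509168) * h1
    - (-3857 / 25509168 * t + 44263 / 31886460) * h2

lemma isSchubertFlag_evenFlag {t : ℂ} (ht : evenQuartic t = 0) : IsSchubertFlag (evenFlag t) := by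
  rw [evenFlag, isSchubertFlag_spanFlag_iff (linearIndependent_evenFlag ht)]
  rw [evenQuartic] at ht
  simp only [detCols, Matrix.cons_val_zero, Matrix.cons_val_one, Matrix.cons_val]
  refine ⟨⟨⟨by ring, by ring⟩, by ring, by ring⟩, ⟨by ring, by ring⟩, ?_, ?_⟩
  · linear_combination (256 * t - 640) * ht
  · linear_combination (-7168 * t - 16640) * ht

lemma exists_eq_evenFlag {P : Submodule ℂ (Fin 5 → ℂ) × Submodule ℂ (Fin 5 → ℂ)}
    (hP : IsSchubertFlag P) {a₁ a₂ a₃ : ℂ} (ha : eigVec a₁ a₂ a₃ 0 0 ∈ P.1)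
    (ha0 : eigVec a₁ a₂ a₃ 0 0 ≠ 0) : ∃ t, evenQuartic t = 0 ∧ P = evenFlag t := by
  obtain ⟨x, y, e₁, e₂, e₃, hPe, hLI⟩ := exists_eq_spanFlag_of_even_mem hP ha ha0
  have hP0 := hP
  rw [hPe, isSchubertFlag_spanFlag_iff hLI] at hP0
  obtain ⟨⟨-, h3, h4⟩, -, h7, h8⟩ := hP0
  simp only [detCols, Matrix.cons_val_zero, Matrix.cons_val_one, Matrix.cons_val] at h7 h8
  have hane : ¬ (a₁ = 0 ∧ a₂ = 0 ∧ a₃ = 0) := by simpa [eigVec_eq_zero] using ha0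
  have hLne : ¬ (a₂ * e₃ - a₃ * e₂ = 0 ∧ -(a₁ * e₃ - a₃ * e₁) = 0 ∧ a₁ * e₂ - a₂ * e₁ = 0) := by
    rintro ⟨hX, hY, hZ⟩
    obtain ⟨m, rfl, rfl, rfl⟩ := exists_smul_of_cross_eq_zero hane hX (neg_eq_zero.1 hY) hZ
    have := linearIndependent_three_iff.1 hLI m 0 (-1) (by
      simp only [smul_eigVec, eigVec_add, eigVec_eq_zero]
      refine ⟨?_, ?_, ?_, ?_, ?_⟩ <;> ring)
    simp at this
  have hxy : ¬ (x = 0 ∧ y = 0) := by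
    rintro ⟨rfl, rfl⟩
    have := linearIndependent_three_iff.1 hLI 0 1 0 (by simp [eigVec_zero])
    simp at this
  have hy : y ≠ 0 := by
    rintro rfl
    have hx : x ≠ 0 := by simpa using hxy
    obtain rfl : a₃ = -13 / 5 * a₂ := mul_left_cancel₀ hx (by linear_combination -h3 / 5)
    obtain rfl : a₁ = 41 / 32 * a₂ := mul_left_cancel₀ hx (by linear_combination -h4 / 32)
    have ha₂ : a₂ ≠ 0 := by rintro rfl; simp at hane
    have h7' : 13 * (a₂ * e₃ + 13 / 5 * a₂ * e₂) - 32 * (41 / 32 * a₂ * e₃ + 13 / 5 * a₂ * e₁)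
        - 32 * (41 / 32 * a₂ * e₂ - a₂ * e₁) = 0 :=
      (mul_eq_zero.1 (by linear_combination h7 : x * _ = 0)).resolve_left hx
    have h8' : -679 * (a₂ * e₃ + 13 / 5 * a₂ * e₂)
        - 256 * (41 / 32 * a₂ * e₃ + 13 / 5 * a₂ * e₁)
        + 896 * (41 / 32 * a₂ * e₂ - a₂ * e₁) = 0 :=
      (mul_eq_zero.1 (by linear_combination h8 : x * _ = 0)).resolve_left hx
    obtain rfl : e₁ = 41 / 32 * e₂ := mul_left_cancel₀ ha₂
      (by linear_combination -5035 / 39168 * h7' + 35 / 9792 * h8')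
    obtain rfl : e₃ = -13 / 5 * e₂ := mul_left_cancel₀ ha₂
      (by linear_combination 61 / 306 * h7' - 1 / 153 * h8')
    exact hLne ⟨by ring, by ring, by ring⟩
  obtain ⟨t, rfl⟩ : ∃ t, x = t * y := ⟨x / y, by field_simp⟩
  have h3' : 29 * a₁ - 13 * a₂ * t - (5 * t + 2) * a₃ = 0 :=
    (mul_eq_zero.1 (by linear_combination h3 : y * _ = 0)).resolve_left hy
  have h4' : (-32 * t - 26) * a₁ + (2 * t + 32) * a₂ + (-15 * t + 3) * a₃ = 0 :=
    (mul_eq_zero.1 (by linear_combination h4 : y * _ = 0)).resolve_left hy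
  have h7' : (13 * t + 8) * (a₂ * e₃ - a₃ * e₂) - (32 * t + 1) * (a₁ * e₃ - a₃ * e₁)
      + (-32 * t + 80) * (a₁ * e₂ - a₂ * e₁) = 0 :=
    (mul_eq_zero.1 (by linear_combination h7 : y * _ = 0)).resolve_left hy
  have h8' : (-679 * t + 64) * (a₂ * e₃ - a₃ * e₂) - (256 * t - 343) * (a₁ * e₃ - a₃ * e₁)
      + (896 * t + 2080) * (a₁ * e₂ - a₂ * e₁) = 0 :=
    (mul_eq_zero.1 (by linear_combination h8 : y * _ = 0)).resolve_left hy
  obtain ⟨k, hk1, hk2, hk3⟩ := exists_smul_of_cross_eq_zero (b₁ := (-205 * t ^ 2 - 125 * t - 64))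
    (b₂ := (-160 * t ^ 2 - 629 * t + 35)) (b₃ := (416 * t ^ 2 + 280 * t - 928)) hane
    (by linear_combination -29 * h4' + (-32 * t - 26) * h3')
    (by linear_combination -13 * t * h4' - (2 * t + 32) * h3')
    (by linear_combination (5 * t + 2) * h4' + (-15 * t + 3) * h3')
  obtain ⟨m, hm1, hm2, hm3⟩ := exists_smul_of_cross_eq_zero (b₁ := (1024 * t ^ 2 + 1000 * t + 820))
    (b₂ := (280 * t ^ 2 - 2516 * t - 320)) (b₃ := (696 * t ^ 2 - 105 * t - 78)) hLne
    (by linear_combination ((13 * t + 8) * h8' - (-679 * t + 64) * h7') / 36)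
    (by linear_combination -((32 * t + 1) * h8' - (256 * t - 343) * h7') / 36)
    (by linear_combination ((-32 * t + 80) * h8' - (896 * t + 2080) * h7') / 36)
  have ht : evenQuartic t = 0 := by
    rw [evenQuartic]
    linear_combination ((1024 * t ^ 2 + 1000 * t + 820) * hk1 + (280 * t ^ 2 - 2516 * t - 320) * hk2
      + (696 * t ^ 2 - 105 * t - 78) * hk3 + k * a₁ * hm1 + k * a₂ * hm2 + k * a₃ * hm3) / 8
  refine ⟨t, ht, eq_spanFlag hP ?_ ?_ ?_ (linearIndependent_evenFlag ht)⟩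
  · rw [hk1, hk2, hk3]
    have := P.1.smul_mem k ha
    rwa [smul_eigVec, mul_zero] at this
  · have hb : eigVec 0 0 0 (t * y) y ∈ P.1 := by
      rw [hPe]
      exact Submodule.subset_span ⟨1, rfl⟩
    have := P.1.smul_mem y⁻¹ hb
    rwa [mul_comm t y, smul_eigVec, inv_mul_cancel_left₀ hy, inv_mul_cancel₀ hy, mul_zero] at this
  · have he : eigVec e₁ e₂ e₃ 0 0 ∈ P.2 := by
      rw [hPe]
      exact Submodule.subset_span ⟨2, rfl⟩
    have := P.2.add_mem (P.2.smul_mem (m * a₃) he) (P.2.smul_mem (-m * e₃) (hP.2.2.1 ha))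
    rw [smul_eigVec, smul_eigVec, eigVec_add] at this
    rw [hm1, hm2]
    convert this using 2 <;> ring

/-- The minimal polynomial of the parameter `ξ` of the flags for which `E₂` has no even vector. -/
def oddQuartic (ξ : ℂ) : ℂ :=
  6623819631 * ξ ^ 4 + 21896575272 * ξ ^ 3 + 14360163136 * ξ ^ 2 - 41332870656 * ξ + 14199349248

/-- The `p`-coordinate, up to a common factor, of the first basis vector of `E₂` in `oddFlag`. -/
def oddP₀ (ξ : ℂ) : ℂ :=
  1486188 * ξ ^ 3 + 4639509 * ξ ^ 2 - 5323144 * ξ + 1225728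

/-- The `q`-coordinate, up to a common factor, of the first basis vector of `E₂` in `oddFlag`. -/
def oddQ₀ (ξ : ℂ) : ℂ :=
  -719037 * ξ ^ 3 + 1221930 * ξ ^ 2 - 623200 * ξ + 199296

/-- The `r`-coordinate, up to a common factor, of the first basis vector of `E₂` in `oddFlag`. -/
def oddR₀ (ξ : ℂ) : ℂ :=
  702999 * ξ ^ 3 + 614448 * ξ ^ 2 + 15389888 * ξ - 9805824

/-- The `p`-coordinate, up to a common factor, of the second basis vector of `E₂` in `oddFlag`. -/
def oddP₁ (ξ : ℂ) : ℂ :=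
  -10467468 * ξ ^ 3 + 10034640 * ξ ^ 2 - 1478240 * ξ - 493056

/-- The `q`-coordinate, up to a common factor, of the second basis vector of `E₂` in `oddFlag`. -/
def oddQ₁ (ξ : ℂ) : ℂ :=
  -12672693 * ξ ^ 3 - 3866445 * ξ ^ 2 + 16409224 * ξ - 5760000

/-- The `r`-coordinate, up to a common factor, of the second basis vector of `E₂` in `oddFlag`. -/
def oddR₁ (ξ : ℂ) : ℂ :=
  24610311 * ξ ^ 3 - 16610616 * ξ ^ 2 - 5633792 * ξ + 3944448

lemma exists_odd_params {p₀ q₀ r₀ p₁ q₁ r₁ ξ : ℂ} (hX : q₀ * r₁ - q₁ * r₀ = ξ - 8)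
    (hY : p₀ * r₁ - p₁ * r₀ = -5 * ξ) (hZ : p₀ * q₁ - p₁ * q₀ = 3 * ξ - 1)
    (h3 : 29 * p₀ + 13 * q₁ - 2 * r₀ + 5 * r₁ = 0)
    (h4 : -26 * p₀ + 32 * p₁ - 2 * q₁ + 32 * q₀ + 15 * r₁ + 3 * r₀ = 0)
    (h7 : 32 * (p₁ * (3 * (45 * ξ - 40)) - q₁ * (3 * (67 * ξ - 32))) - 80 * (q₀ * (3 * (67 * ξ
      - 32))
      - p₀ * (3 * (45 * ξ - 40))) + 32 * (p₁ * (480 - 292 * ξ) - r₁ * (3 * (67 * ξ - 32))) + (r₀ *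
      (3 * (67 * ξ - 32)) - p₀ * (480 - 292 * ξ)) - 13 * (q₁ * (480 - 292 * ξ) - r₁ * (3 * (45 * ξ
      - 40))) - 8 * (r₀ * (3 * (45 * ξ - 40)) - q₀ * (480 - 292 * ξ)) = 0)
    (h8 : -896 * (p₁ * (3 * (45 * ξ - 40)) - q₁ * (3 * (67 * ξ - 32))) - 2080 * (q₀ * (3 * (67 * ξ -
      32)) - p₀ * (3 * (45 * ξ - 40))) + 256 * (p₁ * (480 - 292 * ξ) - r₁ * (3 * (67 * ξ - 32))) -
      343 * (r₀ * (3 * (67 * ξ - 32)) - p₀ * (480 - 292 * ξ)) + 679 * (q₁ * (480 - 292 * ξ) - r₁ *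
      (3 * (45 * ξ - 40))) - 64 * (r₀ * (3 * (45 * ξ - 40)) - q₀ * (480 - 292 * ξ)) = 0) :
    oddQuartic ξ = 0 ∧ ∃ μ, μ ^ 2 * (oddQ₀ ξ * oddR₁ ξ - oddQ₁ ξ * oddR₀ ξ) = ξ - 8 ∧
      p₀ = μ * oddP₀ ξ ∧ q₀ = μ * oddQ₀ ξ ∧ r₀ = μ * oddR₀ ξ ∧
      p₁ = μ * oddP₁ ξ ∧ q₁ = μ * oddQ₁ ξ ∧ r₁ = μ * oddR₁ ξ := by
  have hr0 : -547 * p₀ * ξ + 6696 * q₀ * ξ + 2801 * q₁ * ξ + 1671 * r₁ * ξ + 1926 * p₀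
    + 1926 * q₁ + 2214
      * r₁ = 0 := by
    linear_combination -1 / 2 * h7 + 54 * h3 + 102 * ξ * h3 + 180 * h4 - 157 / 2 * ξ * h4
  have hr1 : 1674559 * p₀ * ξ + 482112 * q₀ * ξ + 830863 * q₁ * ξ + 398937 * r₁ * ξ - 755712 * p₀ -
      755712 * q₁ - 91152 * r₁ = 0 := by
    linear_combination -2 * h8 - 19008 * h3 + 59235 * ξ * h3 + 14400 * h4 - 12232 * ξ * h4
  have hr2 : 89 * p₀ * ξ + 10 * q₀ * ξ + 39 * q₁ * ξ + 15 * r₁ * ξ - 45 * p₀ - 13 * q₁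
    - 5 * r₁ = 0 := by
    linear_combination -2 * (p₀ * hX - q₀ * hY + r₀ * hZ) - h3 + 3 * ξ * h3
  have hr3 : -35 * p₀ * ξ - 64 * q₀ * ξ + 285 * q₁ * ξ + 147 * r₁ * ξ + 280 * p₀ + 512 * q₀
    + 280 * q₁ +
      296 * r₁ = 0 := by
    linear_combination -64 * (p₁ * hX - q₁ * hY + r₁ * hZ) + 24 * h3 - 3 * ξ * h3 + 16 * h4
      - 2 * ξ * h4
  have h01 : oddQ₀ ξ * p₀ = oddP₀ ξ * q₀ := by
    simp only [oddP₀, oddQ₀]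
    linear_combination (-729 / 4 * ξ ^ 2 - 3429 / 4 * ξ + 306) * hr0 + (-8061 * ξ ^ 2
      + 3337 / 2 * ξ - 6228) * hr2
      + (11577 / 4 * ξ ^ 2 + 24869 / 4 * ξ - 2394) * hr3
  have h02 : oddQ₁ ξ * p₀ = oddP₀ ξ * q₁ := by
    simp only [oddP₀, oddQ₁]
    linear_combination (1215 / 4 * ξ ^ 2 - 630 * ξ + 320) * hr0 + (-136407 * ξ ^ 2 - 158520 * ξ
      + 141696) * hr2 +
      (41865 / 4 * ξ ^ 2 - 13905 / 2 * ξ) * hr3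
  have h03 : oddR₁ ξ * p₀ = oddP₀ ξ * r₁ := by
    simp only [oddP₀, oddR₁]
    linear_combination (-2673 / 4 * ξ ^ 2 + 2250 * ξ - 832) * hr0 + (260953 * ξ ^ 2 + 70504 * ξ
      - 123264) * hr2 +
      (-116567 / 4 * ξ ^ 2 + 26577 / 2 * ξ) * hr3
  have h12 : oddQ₁ ξ * q₀ = oddQ₀ ξ * q₁ := by
    simp only [oddQ₀, oddQ₁]
    linear_combination (-1701 * ξ ^ 2 - 7677 / 4 * ξ + 1490) * hr0 + (-5481 / 2 * ξ ^ 2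
      - 67295 / 2 * ξ - 6228) *
      hr2 + (39231 / 2 * ξ ^ 2 + 45113 / 4 * ξ - 11250) * hr3
  have h13 : oddR₁ ξ * q₀ = oddQ₀ ξ * r₁ := by
    simp only [oddQ₀, oddR₁]
    linear_combination (13365 / 4 * ξ ^ 2 + 90 * ξ - 1120) * hr0 + (14465 / 2 * ξ ^ 2
      + 40140 * ξ) * hr2 + (-135311
      / 4 * ξ ^ 2 + 4607 * ξ + 7704) * hr3
  have h23 : oddR₁ ξ * q₁ = oddQ₁ ξ * r₁ := by
    simp only [oddQ₁, oddR₁]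
    linear_combination (2673 / 4 * ξ ^ 2 - 5706 * ξ + 2880) * hr0 + (33671 * ξ ^ 2 - 284776 * ξ
      + 123264) * hr2 +
      (300707 / 4 * ξ ^ 2 - 80145 / 2 * ξ) * hr3
  have hdet : 216 * oddQuartic ξ = (1674559 * ξ - 755712) * oddP₀ ξ + (482112 * ξ) * oddQ₀ ξ
    + (830863 * ξ - 755712) * oddQ₁ ξ
      + (398937 * ξ - 91152) * oddR₁ ξ := by
    simp only [oddQuartic, oddP₀, oddQ₀, oddQ₁, oddR₁]
    ring
  have hd0 : oddQuartic ξ * p₀ = 0 := by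
    linear_combination (oddP₀ ξ * hr1 + p₀ * hdet + (482112 * ξ) * h01 + (830863 * ξ
      - 755712) * h02 + (398937 * ξ
      - 91152) * h03) / 216
  have hd1 : oddQuartic ξ * q₀ = 0 := by
    linear_combination (oddQ₀ ξ * hr1 + q₀ * hdet - (1674559 * ξ - 755712) * h01 + (830863 * ξ
      - 755712) * h12 +
      (398937 * ξ - 91152) * h13) / 216
  have hd2 : oddQuartic ξ * q₁ = 0 := by
    linear_combination (oddQ₁ ξ * hr1 + q₁ * hdet - (1674559 * ξ - 755712) * h02
      - (482112 * ξ) * h12 + (398937 * ξ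
      - 91152) * h23) / 216
  have hd3 : oddQuartic ξ * r₁ = 0 := by
    linear_combination (oddR₁ ξ * hr1 + r₁ * hdet - (1674559 * ξ - 755712) * h03
      - (482112 * ξ) * h13 - (830863 * ξ
      - 755712) * h23) / 216
  have hD : oddQuartic ξ = 0 := by
    by_contra hD
    have hp₀ := (mul_eq_zero.1 hd0).resolve_left hD
    have hq₀ := (mul_eq_zero.1 hd1).resolve_left hD
    have hq₁ := (mul_eq_zero.1 hd2).resolve_left hD
    have hr₁ := (mul_eq_zero.1 hd3).resolve_left hD
    subst hp₀ hq₀ hq₁ hr₁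
    have : (1 : ℂ) = 0 := by linear_combination (3 * hX - hZ) / 23
    exact one_ne_zero this
  have hR₁ : oddR₁ ξ ≠ 0 := by
    intro h
    have : (1 : ℂ) = 0 := by
      rw [oddR₁] at h
      rw [oddQuartic] at hD
      linear_combination (60052360832382788892530441791 / 7461576942748446368679776749617152 * ξ ^
        3 +
        29565737716121863165113360631189 / 975834359543820251653902053035868160 * ξ ^ 2 +
        27452894471983725561499596599257 / 878250923589438226488511847732281344 * ξ -
        122919263346993569660432570969 / 3388313748416042540464937684152320) * h +
        (-223120096666345851121277271 / 7461576942748446368679776749617152 * ξ ^ 2 +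
        65693467143776857318696961 / 10164941245248127621394813052456960 * ξ +
        2785141259857684774261700629 / 274453413621699445777659952416337920) * hD
    exact one_ne_zero this
  obtain ⟨μ, rfl⟩ : ∃ μ, r₁ = μ * oddR₁ ξ := ⟨r₁ / oddR₁ ξ, by field_simp⟩
  obtain rfl : p₀ = μ * oddP₀ ξ := mul_left_cancel₀ hR₁ (by linear_combination h03)
  obtain rfl : q₀ = μ * oddQ₀ ξ := mul_left_cancel₀ hR₁ (by linear_combination h13)
  obtain rfl : q₁ = μ * oddQ₁ ξ := mul_left_cancel₀ hR₁ (by linear_combination h23)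
  obtain rfl : r₀ = μ * oddR₀ ξ := by
    simp only [oddP₀, oddQ₁, oddR₀, oddR₁] at h3 ⊢
    linear_combination -h3 / 2
  obtain rfl : p₁ = μ * oddP₁ ξ := by
    simp only [oddP₀, oddQ₀, oddQ₁, oddR₀, oddR₁, oddP₁] at h4 ⊢
    linear_combination h4 / 32
  exact ⟨hD, μ, by linear_combination hX, rfl, rfl, rfl, rfl, rfl, rfl⟩

/-- The candidate solutions for which `E₂` contains no even vector. -/
def oddFlag (ξ μ : ℂ) : Submodule ℂ (Fin 5 → ℂ) × Submodule ℂ (Fin 5 → ℂ) :=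
  spanFlag (eigVec (μ * oddP₀ ξ) (μ * oddQ₀ ξ) (μ * oddR₀ ξ) 1 0)
    (eigVec (μ * oddP₁ ξ) (μ * oddQ₁ ξ) (μ * oddR₁ ξ) 0 1)
    (eigVec (3 * (67 * ξ - 32)) (3 * (45 * ξ - 40)) (480 - 292 * ξ) 0 0)

lemma linearIndependent_odd {p₀ q₀ r₀ p₁ q₁ r₁ e₁ e₂ e₃ : ℂ}
    (h : ¬ (e₁ = 0 ∧ e₂ = 0 ∧ e₃ = 0)) :
    LinearIndependent ℂ ![eigVec p₀ q₀ r₀ 1 0, eigVec p₁ q₁ r₁ 0 1, eigVec e₁ e₂ e₃ 0 0] := by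
  rw [linearIndependent_three_iff]
  intro a b c habc
  simp only [smul_eigVec, eigVec_add, eigVec_eq_zero] at habc
  obtain ⟨h1, h2, h3, h4, h5⟩ := habc
  obtain rfl : a = 0 := by linear_combination h4
  obtain rfl : b = 0 := by linear_combination h5
  refine ⟨rfl, rfl, ?_⟩
  by_contra hc
  refine h ⟨mul_left_cancel₀ hc ?_, mul_left_cancel₀ hc ?_, mul_left_cancel₀ hc ?_⟩
  · linear_combination h1
  · linear_combination h2
  · linear_combination h3

lemma linearIndependent_oddFlag {p₀ q₀ r₀ p₁ q₁ r₁ ξ : ℂ} :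
    LinearIndependent ℂ ![eigVec p₀ q₀ r₀ 1 0, eigVec p₁ q₁ r₁ 0 1,
      eigVec (3 * (67 * ξ - 32)) (3 * (45 * ξ - 40)) (480 - 292 * ξ) 0 0] := by
  refine linearIndependent_odd fun ⟨h1, h2, _⟩ => one_ne_zero (α := ℂ) ?_
  linear_combination (45 * h1 - 67 * h2) / 3720

lemma isSchubertFlag_oddFlag {ξ μ : ℂ} (hξ : oddQuartic ξ = 0)
    (hμ : μ ^ 2 * (oddQ₀ ξ * oddR₁ ξ - oddQ₁ ξ * oddR₀ ξ) = ξ - 8) :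
    IsSchubertFlag (oddFlag ξ μ) := by
  rw [oddQuartic] at hξ
  have h8 : ξ - 8 ≠ 0 := by
    intro h
    obtain rfl : ξ = 8 := by linear_combination h
    norm_num at hξ
  have hY : μ ^ 2 * (oddP₀ ξ * oddR₁ ξ - oddP₁ ξ * oddR₀ ξ) = -5 * ξ := by
    refine mul_left_cancel₀ h8 ?_
    have : (ξ - 8) * (oddP₀ ξ * oddR₁ ξ - oddP₁ ξ * oddR₀ ξ)
        + 5 * ξ * (oddQ₀ ξ * oddR₁ ξ - oddQ₁ ξ * oddR₀ ξ) = 0 := by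
      simp only [oddP₀, oddQ₀, oddR₀, oddP₁, oddQ₁, oddR₁]
      ring
    linear_combination μ ^ 2 * this - 5 * ξ * hμ
  have hZ : μ ^ 2 * (oddP₀ ξ * oddQ₁ ξ - oddP₁ ξ * oddQ₀ ξ) = 3 * ξ - 1 := by
    refine mul_left_cancel₀ h8 ?_
    have : (ξ - 8) * (oddP₀ ξ * oddQ₁ ξ - oddP₁ ξ * oddQ₀ ξ)
        - (3 * ξ - 1) * (oddQ₀ ξ * oddR₁ ξ - oddQ₁ ξ * oddR₀ ξ) = 0 := by
      simp only [oddP₀, oddQ₀, oddR₀, oddP₁, oddQ₁, oddR₁]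
      ring
    linear_combination μ ^ 2 * this + (3 * ξ - 1) * hμ
  rw [oddFlag, isSchubertFlag_spanFlag_iff linearIndependent_oddFlag]
  simp only [detCols, Matrix.cons_val_zero, Matrix.cons_val_one, Matrix.cons_val]
  refine ⟨⟨⟨?_, ?_⟩, ?_, ?_⟩, ⟨?_, ?_⟩, ?_, ?_⟩
  · linear_combination 11 * hZ + 7 * hY + 2 * hμ
  · linear_combination 2 * hZ + hY - hμ
  · simp only [oddP₀, oddQ₀, oddR₀, oddP₁, oddQ₁, oddR₁]
    ring
  · simp only [oddP₀, oddQ₀, oddR₀, oddP₁, oddQ₁, oddR₁]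
    ring
  · linear_combination 9 * (3 * (67 * ξ - 32) * hμ - 3 * (45 * ξ - 40) * hY
      + (480 - 292 * ξ) * hZ)
  · linear_combination 81 * (3 * (67 * ξ - 32) * hμ - 3 * (45 * ξ - 40) * hY
      + (480 - 292 * ξ) * hZ)
  · simp only [oddP₀, oddQ₀, oddR₀, oddP₁, oddQ₁, oddR₁]
    ring
  · simp only [oddP₀, oddQ₀, oddR₀, oddP₁, oddQ₁, oddR₁]
    linear_combination -108 * μ * hξ

/-- If `E₂` contains no nonzero even vector, it has a basis with odd parts `(1, 0)` and `(0, 1)`. -/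
lemma exists_odd_basis {E : Submodule ℂ (Fin 5 → ℂ)} (hE : Module.finrank ℂ E = 2)
    (h : ∀ a₁ a₂ a₃, eigVec a₁ a₂ a₃ 0 0 ∈ E → eigVec a₁ a₂ a₃ 0 0 = 0) :
    (∃ p q r, eigVec p q r 1 0 ∈ E) ∧ ∃ p q r, eigVec p q r 0 1 ∈ E := by
  obtain ⟨u, hu, hu0⟩ : ∃ u ∈ E, u ≠ 0 := by
    refine E.ne_bot_iff.1 ?_
    rintro rfl
    simp at hE
  obtain ⟨v, hv, huv⟩ := exists_mem_linearIndependent_two hE hu0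
  obtain ⟨a₁, a₂, a₃, x₀, y₀, rfl⟩ := exists_eigVec u
  obtain ⟨c₁, c₂, c₃, x₁, y₁, rfl⟩ := exists_eigVec v
  rw [LinearIndependent.pair_iff] at huv
  have hcomb (s t : ℂ) : eigVec (s * a₁ + t * c₁) (s * a₂ + t * c₂) (s * a₃ + t * c₃)
      (s * x₀ + t * x₁) (s * y₀ + t * y₁) ∈ E := by
    rw [← eigVec_add, ← smul_eigVec, ← smul_eigVec]
    exact E.add_mem (E.smul_mem s hu) (E.smul_mem t hv)
  have hzero (s t : ℂ) (hx : s * x₀ + t * x₁ = 0) (hy : s * y₀ + t * y₁ = 0) : s = 0 ∧ t = 0 := by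
    have := hcomb s t
    rw [hx, hy] at this
    refine huv s t ?_
    rw [smul_eigVec, smul_eigVec, eigVec_add, hx, hy]
    exact h _ _ _ this
  have hδ : x₀ * y₁ - x₁ * y₀ ≠ 0 := by
    intro hδ
    obtain ⟨rfl, h0⟩ := hzero y₁ (-y₀) (by linear_combination hδ) (by ring)
    obtain rfl := neg_eq_zero.1 h0
    obtain ⟨rfl, h1⟩ := hzero x₁ (-x₀) (by ring) (by ring)
    obtain rfl := neg_eq_zero.1 h1
    exact one_ne_zero (hzero 1 0 (by ring) (by ring)).1
  constructor
  · have := hcomb (y₁ / (x₀ * y₁ - x₁ * y₀)) (-y₀ / (x₀ * y₁ - x₁ * y₀))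
    rw [show y₁ / (x₀ * y₁ - x₁ * y₀) * x₀ + -y₀ / (x₀ * y₁ - x₁ * y₀) * x₁ = 1 by
      rw [div_mul_eq_mul_div, div_mul_eq_mul_div, ← add_div, div_eq_one_iff_eq hδ]; ring, show y₁ /
        (x₀ * y₁ - x₁ * y₀) * y₀ + -y₀ / (x₀ * y₁ - x₁ * y₀) * y₁ = 0 by
      ring] at this
    exact ⟨_, _, _, this⟩
  · have := hcomb (-x₁ / (x₀ * y₁ - x₁ * y₀)) (x₀ / (x₀ * y₁ - x₁ * y₀))
    rw [show -x₁ / (x₀ * y₁ - x₁ * y₀) * x₀ + x₀ / (x₀ * y₁ - x₁ * y₀) * x₁ = 0 by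
      ring, show -x₁ / (x₀ * y₁ - x₁ * y₀) * y₀ + x₀ / (x₀ * y₁ - x₁ * y₀) * y₁ = 1 by
      rw [div_mul_eq_mul_div, div_mul_eq_mul_div, ← add_div, div_eq_one_iff_eq hδ]; ring] at this
    exact ⟨_, _, _, this⟩

lemma exists_eq_oddFlag {P : Submodule ℂ (Fin 5 → ℂ) × Submodule ℂ (Fin 5 → ℂ)}
    (hP : IsSchubertFlag P)
    (h : ∀ a₁ a₂ a₃, eigVec a₁ a₂ a₃ 0 0 ∈ P.1 → eigVec a₁ a₂ a₃ 0 0 = 0) :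
    ∃ ξ μ, (oddQuartic ξ = 0 ∧ μ ^ 2 * (oddQ₀ ξ * oddR₁ ξ - oddQ₁ ξ * oddR₀ ξ) = ξ - 8) ∧
      P = oddFlag ξ μ := by
  obtain ⟨⟨p₀, q₀, r₀, hf₀⟩, p₁, q₁, r₁, hf₁⟩ := exists_odd_basis hP.1 h
  obtain ⟨w, hw, hLI⟩ := exists_mem_linearIndependent_three hP.2.1
    (linearIndependent_two_of_three
      (linearIndependent_odd (p₀ := p₀) (q₀ := q₀) (r₀ := r₀) (p₁ := p₁) (q₁ := q₁) (r₁ := r₁)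
        (e₁ := 1) (e₂ := 0) (e₃ := 0) (by simp)))
  obtain ⟨e₁, e₂, e₃, hwe, hene⟩ : ∃ e₁ e₂ e₃, eigVec e₁ e₂ e₃ 0 0 ∈ P.2 ∧
      ¬ (e₁ = 0 ∧ e₂ = 0 ∧ e₃ = 0) := by
    obtain ⟨w₁, w₂, w₃, x, y, rfl⟩ := exists_eigVec w
    have heq : eigVec w₁ w₂ w₃ x y + (-x) • eigVec p₀ q₀ r₀ 1 0 + (-y) • eigVec p₁ q₁ r₁ 0 1 =
        eigVec (w₁ - x * p₀ - y * p₁) (w₂ - x * q₀ - y * q₁) (w₃ - x * r₀ - y * r₁) 0 0 := by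
      rw [smul_eigVec, smul_eigVec, eigVec_add, eigVec_add, eigVec_inj]
      refine ⟨?_, ?_, ?_, ?_, ?_⟩ <;> ring
    refine ⟨_, _, _, heq ▸ P.2.add_mem (P.2.add_mem hw (P.2.smul_mem _ (hP.2.2.1 hf₀)))
      (P.2.smul_mem _ (hP.2.2.1 hf₁)), ?_⟩
    rintro ⟨h1, h2, h3⟩
    rw [h1, h2, h3, eigVec_zero] at heq
    have := linearIndependent_three_iff.1 hLI (-x) (-y) 1 (by rw [← heq]; module)
    exact one_ne_zero this.2.2
  have hP0 := hP
  rw [eq_spanFlag hP hf₀ hf₁ hwe (linearIndependent_odd hene),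
    isSchubertFlag_spanFlag_iff (linearIndependent_odd hene)] at hP0
  obtain ⟨⟨⟨h1, h2⟩, -⟩, ⟨h5, h6⟩, -⟩ := hP0
  simp only [detCols, Matrix.cons_val_zero, Matrix.cons_val_one, Matrix.cons_val] at h5 h6
  obtain ⟨ξ, hX⟩ : ∃ ξ, q₀ * r₁ - q₁ * r₀ = ξ - 8 := ⟨q₀ * r₁ - q₁ * r₀ + 8, by ring⟩
  have hZ : p₀ * q₁ - p₁ * q₀ = 3 * ξ - 1 := by
    linear_combination 7 / 3 * h2 - h1 / 3 + 3 * hX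
  have hY : p₀ * r₁ - p₁ * r₀ = -5 * ξ := by
    linear_combination h2 + hX - 2 * hZ
  have he : eigVec (3 * (67 * ξ - 32)) (3 * (45 * ξ - 40)) (480 - 292 * ξ) 0 0 ∈ P.2 := by
    have hS : 40 * e₁ - 92 * e₂ - 15 * e₃ = 0 := by linear_combination (9 * h5 - h6) / 4
    have hR : e₁ * (45 * ξ - 40) - e₂ * (67 * ξ - 32) = 0 := by
      linear_combination 5 / 9 * h5 - 5 * (e₁ * hX - e₂ * hY + e₃ * hZ) + (9 * ξ - 4) / 9 * hS
    obtain ⟨κ, hκ⟩ : ∃ κ, 45 * e₁ - 67 * e₂ = 3720 * κ := ⟨(45 * e₁ - 67 * e₂) / 3720, by ring⟩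
    have h₁ : e₁ = κ * (3 * (67 * ξ - 32)) := by
      linear_combination (3 * (67 * ξ - 32) * hκ - 201 * hR) / 3720
    have h₂ : e₂ = κ * (3 * (45 * ξ - 40)) := by
      linear_combination (3 * (45 * ξ - 40) * hκ - 135 * hR) / 3720
    have h₃ : e₃ = κ * (480 - 292 * ξ) := by
      linear_combination (40 * h₁ - 92 * h₂ - hS) / 15
    have hκ0 : κ ≠ 0 := by
      rintro rfl
      simp [h₁, h₂, h₃] at hene
    have := P.2.smul_mem κ⁻¹ hwe
    rwa [smul_eigVec, h₁, h₂, h₃, inv_mul_cancel_left₀ hκ0, inv_mul_cancel_left₀ hκ0,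
      inv_mul_cancel_left₀ hκ0, mul_zero] at this
  have hP0 := hP
  have hPe := eq_spanFlag hP hf₀ hf₁ he linearIndependent_oddFlag
  rw [hPe, isSchubertFlag_spanFlag_iff linearIndependent_oddFlag] at hP0
  obtain ⟨⟨-, h3, h4⟩, -, h7, h8⟩ := hP0
  simp only [detCols, Matrix.cons_val_zero, Matrix.cons_val_one, Matrix.cons_val] at h7 h8
  obtain ⟨hD, μ, hμ, rfl, rfl, rfl, rfl, rfl, rfl⟩ := exists_odd_params hX hY hZ
    (by linear_combination h3) (by linear_combination h4) (by linear_combination h7)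
    (by linear_combination h8)
  exact ⟨ξ, μ, ⟨hD, hμ⟩, hPe⟩

lemma oddQuartic_ofReal_ne_zero (x : ℝ) : oddQuartic x ≠ 0 := by
  have h : 0 < 6623819631 * x ^ 4 + 21896575272 * x ^ 3 + 14360163136 * x ^ 2 - 41332870656 * x
      + 14199349248 := by
    nlinarith [sq_nonneg (x ^ 2 + 773348 / 467883 * x - 31 / 25),
      sq_nonneg (x - 708878163918 / 1268800835652), sq_nonneg x]
  rw [oddQuartic]
  exact_mod_cast h.ne'

lemma evenQuartic_ofReal_ne_zero (x : ℝ) : evenQuartic x ≠ 0 := by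
  have h : 0 < 4352 * x ^ 4 + 5580 * x ^ 3 + 72149 * x ^ 2 + 2790 * x + 1088 := by
    nlinarith [sq_nonneg (x ^ 2 + 5580 / 8704 * x), sq_nonneg (x + 1395 / 70000), sq_nonneg x]
  rw [evenQuartic]
  exact_mod_cast h.ne'

open Polynomial in
lemma ncard_quartic_roots {a b c d e : ℂ} (ha : a ≠ 0)
    (h : ∀ x, a * x ^ 4 + b * x ^ 3 + c * x ^ 2 + d * x + e = 0 →
      4 * a * x ^ 3 + 3 * b * x ^ 2 + 2 * c * x + d ≠ 0) :
    {x | a * x ^ 4 + b * x ^ 3 + c * x ^ 2 + d * x + e = 0}.ncard = 4 := by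
  set p : ℂ[X] := C a * X ^ 4 + C b * X ^ 3 + C c * X ^ 2 + C d * X + C e with hp
  have hdeg : p.natDegree = 4 := by
    rw [hp]
    compute_degree!
  have hp0 : p ≠ 0 := by
    intro h0
    simp [h0] at hdeg
  have hsep : p.Separable := by
    refine (isCoprime_iff_aeval_ne_zero_of_isAlgClosed ℂ ℂ _ _).2 fun x => ?_
    rw [or_iff_not_imp_left, not_not]
    intro hx
    have hx' : a * x ^ 4 + b * x ^ 3 + c * x ^ 2 + d * x + e = 0 := by simpa [hp] using hx
    convert h x hx' using 1
    simp [hp]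
    ring
  have hset : {x | a * x ^ 4 + b * x ^ 3 + c * x ^ 2 + d * x + e = 0} = p.rootSet ℂ := by
    ext x
    rw [mem_rootSet_of_ne hp0]
    simp [hp]
  rw [hset, ← Nat.card_coe_set_eq, Nat.card_eq_fintype_card,
    card_rootSet_eq_natDegree hsep (IsAlgClosed.splits _), hdeg]

lemma ncard_evenQuartic : {t | evenQuartic t = 0}.ncard = 4 := by
  convert ncard_quartic_roots (a := 4352) (b := 5580) (c := 72149) (d := 2790) (e := 1088)
    (by norm_num) ?_ using 1
  · rfl
  intro t ht h'
  refine one_ne_zero (α := ℂ) ?_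
  linear_combination (47634955690496 / 415830423349669311 * t ^ 2
    + 161611254110 / 1490431624909209 * t +
    156425109577 / 165603513878801) * ht + (-11908738922624 / 415830423349669311 * t ^ 3
      - 54084728650 / 1490431624909209 * t ^ 2 -
    393704027453249 / 831660846699338622 * t - 9864527615 / 993621083272806) * h'

lemma ncard_oddQuartic : {ξ | oddQuartic ξ = 0}.ncard = 4 := by
  convert ncard_quartic_roots (a := 6623819631) (b := 21896575272) (c := 14360163136)
    (d := -41332870656) (e := 14199349248) (by norm_num) ?_ using 1
  · simp only [oddQuartic]
    ring_nf
  intro ξ hξ h'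
  refine one_ne_zero (α := ℂ) ?_
  linear_combination (939264738287874971583 / 239736644470157065735070285824 * ξ ^ 2
    + 132784477052371158165359 /
    11147753967862303556680768290816 * ξ + 411412614921456723701459 /
    37623669641535274503797592981504) * hξ + (-939264738287874971583 /
      958946577880628262940281143296 * ξ ^ 3 - 31664927353788095561675 /
    8360815475896727667510576218112 * ξ ^ 2 - 1758709068962219722462535 /
    413860366056888019541773522796544 * ξ + 1532415509007907299571 /
    410575759977071447958108653568) * h'

lemma odd_cross_ne_zero {ξ : ℂ} (hξ : oddQuartic ξ = 0) :
    oddQ₀ ξ * oddR₁ ξ - oddQ₁ ξ * oddR₀ ξ ≠ 0 := by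
  intro h
  rw [oddQuartic] at hξ
  simp only [oddQ₀, oddR₁, oddQ₁, oddR₀] at h
  refine one_ne_zero (α := ℂ) ?_
  linear_combination (22137728495230634120758645511894925427070658623 /
    34312351155871439192004309043180141834259696896784203776 * ξ ^ 3 +
    559784066795971505291779226696386145007072298315 /
    224370608730190582841465677102670146213088799239127957504 * ξ ^ 2 +
    11302027453491246433449356301524461711097193935465 /
    4038670957143430491146382187848062631835598386304303235072 * ξ -
    22976687767288138019644039484397550440929588093 /
    9348775363757940951727736545944589425545366634963664896) * h
      + (468298102783724952554509808905469576341879317025 /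
    547161978308649493288134557787337652706816154218266624 * ξ ^ 5 -
    547835099064170393767075072818368009731311314879327 /
    118186987314668290550237064482064932984672289311145590784 * ξ ^ 4 -
    3516230547559474979202447321097153391807643878661805 /
    199440541093502740303525046313484574411634488212558184448 * ξ ^ 3 -
    1586357409018182770997978788802220232589137350474385 /
    448741217460381165682931354205340292426177598478255915008 * ξ ^ 2 +
    178722749851617615350312658141546423678690634170383 /
    7011581522818455713795802409458442069159024976222748672 * ξ -
    469390362833377400123078673466768501901926587785 /
    48691538352905942456915294510128069924715451223769088) * hξ

lemma ne_eight_of_oddQuartic_eq_zero {ξ : ℂ} (hξ : oddQuartic ξ = 0) : ξ - 8 ≠ 0 := by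
  intro h
  obtain rfl : ξ = 8 := by linear_combination h
  norm_num [oddQuartic] at hξ

/-- The parameters of the flags `oddFlag ξ μ` solving the Schubert problem. -/
def oddParams : Set (ℂ × ℂ) :=
  {z | oddQuartic z.1 = 0 ∧ z.2 ^ 2 * (oddQ₀ z.1 * oddR₁ z.1 - oddQ₁ z.1 * oddR₀ z.1) = z.1 - 8}

lemma ncard_oddParams : oddParams.ncard = 8 := by
  choose s hs using fun ξ : ℂ => IsAlgClosed.exists_pow_nat_eq
    ((ξ - 8) / (oddQ₀ ξ * oddR₁ ξ - oddQ₁ ξ * oddR₀ ξ)) two_pos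
  have hs0 {ξ : ℂ} (hξ : oddQuartic ξ = 0) : s ξ ≠ 0 := by
    intro h
    have := hs ξ
    rw [h, zero_pow two_ne_zero, eq_comm, div_eq_zero_iff] at this
    exact this.elim (ne_eight_of_oddQuartic_eq_zero hξ) (odd_cross_ne_zero hξ)
  have himage : oddParams = (fun z : ℂ × ℂ => (z.1, z.2 * s z.1)) ''
      ({ξ | oddQuartic ξ = 0} ×ˢ {1, -1}) := by
    ext ⟨ξ, μ⟩
    simp only [oddParams, Set.mem_ofPred_eq, Set.mem_image, Set.mem_prod, Set.mem_insert_iff,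
      Set.mem_singleton_iff, Prod.exists, Prod.mk.injEq]
    constructor
    · rintro ⟨hξ, hμ⟩
      rw [← eq_div_iff (odd_cross_ne_zero hξ), ← hs, sq_eq_sq_iff_eq_or_eq_neg] at hμ
      rcases hμ with rfl | rfl
      · exact ⟨ξ, 1, ⟨hξ, .inl rfl⟩, rfl, one_mul _⟩
      · exact ⟨ξ, -1, ⟨hξ, .inr rfl⟩, rfl, neg_one_mul _⟩
    · rintro ⟨_, ε, ⟨hξ, hε⟩, rfl, rfl⟩
      have hε2 : ε ^ 2 = 1 := by rcases hε with rfl | rfl <;> norm_num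
      rw [mul_pow, hε2, one_mul, hs, div_mul_cancel₀ _ (odd_cross_ne_zero hξ)]
      exact ⟨hξ, rfl⟩
  rw [himage, Set.InjOn.ncard_image, Set.ncard_prod, ncard_oddQuartic,
    Set.ncard_pair (by norm_num)]
  rintro ⟨ξ, ε⟩ ⟨hξ, -⟩ ⟨ξ', ε'⟩ - h
  simp only [Prod.mk.injEq] at h
  obtain ⟨rfl, h⟩ := h
  rw [mul_right_cancel₀ (hs0 hξ) h]

lemma eq_of_mem_oddFlag {ξ μ p q r x y : ℂ} (h : eigVec p q r x y ∈ (oddFlag ξ μ).1) :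
    p = x * (μ * oddP₀ ξ) + y * (μ * oddP₁ ξ) ∧ q = x * (μ * oddQ₀ ξ) + y * (μ * oddQ₁ ξ) ∧
      r = x * (μ * oddR₀ ξ) + y * (μ * oddR₁ ξ) := by
  obtain ⟨a, b, h⟩ := mem_span_range_two.1 h
  simp only [smul_eigVec, eigVec_add, eigVec_inj, mul_one, mul_zero, add_zero, zero_add] at h
  obtain ⟨h₁, h₂, h₃, rfl, rfl⟩ := h
  exact ⟨h₁, h₂, h₃⟩

lemma mem_oddFlag_left (ξ μ : ℂ) :
    eigVec (μ * oddP₀ ξ) (μ * oddQ₀ ξ) (μ * oddR₀ ξ) 1 0 ∈ (oddFlag ξ μ).1 :=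
  Submodule.subset_span ⟨0, rfl⟩

lemma mem_oddFlag_right (ξ μ : ℂ) :
    eigVec (μ * oddP₁ ξ) (μ * oddQ₁ ξ) (μ * oddR₁ ξ) 0 1 ∈ (oddFlag ξ μ).1 :=
  Submodule.subset_span ⟨1, rfl⟩

lemma injOn_oddFlag : Set.InjOn (fun z : ℂ × ℂ => oddFlag z.1 z.2) oddParams := by
  rintro ⟨ξ, μ⟩ ⟨hξ, hμ⟩ ⟨ξ', μ'⟩ ⟨-, hμ'⟩ h
  simp only at hξ hμ hμ' h
  have h0 := mem_oddFlag_left ξ μ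
  have h1 := mem_oddFlag_right ξ μ
  rw [h] at h0 h1
  obtain ⟨-, hQ₀, hR₀⟩ := eq_of_mem_oddFlag h0
  obtain ⟨-, hQ₁, hR₁⟩ := eq_of_mem_oddFlag h1
  simp only [one_mul, zero_mul, add_zero, zero_add] at hQ₀ hR₀ hQ₁ hR₁
  obtain rfl : ξ = ξ' := by
    linear_combination hμ' - hμ + μ * oddR₁ ξ * hQ₀ + μ' * oddQ₀ ξ' * hR₁
      - μ * oddR₀ ξ * hQ₁ - μ' * oddQ₁ ξ' * hR₀
  rw [mul_right_cancel₀ (odd_cross_ne_zero hξ)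
    (by linear_combination oddR₁ ξ * hQ₀ - oddR₀ ξ * hQ₁ : μ * _ = μ' * _)]

lemma eq_of_mem_evenFlag {t x : ℂ} (h : eigVec 0 0 0 x 1 ∈ (evenFlag t).1) : x = t := by
  obtain ⟨a, b, h⟩ := mem_span_range_two.1 h
  simp only [smul_eigVec, eigVec_add, eigVec_inj, mul_one, mul_zero, add_zero, zero_add] at h
  obtain ⟨-, -, -, h, rfl⟩ := h
  rw [h, one_mul]

lemma mem_evenFlag (t : ℂ) : eigVec 0 0 0 t 1 ∈ (evenFlag t).1 :=
  Submodule.subset_span ⟨1, rfl⟩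

lemma injective_evenFlag : Function.Injective evenFlag := by
  intro t t' h
  have := mem_evenFlag t
  rw [h] at this
  exact eq_of_mem_evenFlag this

lemma evenFlag_ne_oddFlag {t ξ μ : ℂ} (ht : evenQuartic t = 0) : evenFlag t ≠ oddFlag ξ μ := by
  intro h
  have hmem : eigVec (-205 * t ^ 2 - 125 * t - 64) (-160 * t ^ 2 - 629 * t + 35)
      (416 * t ^ 2 + 280 * t - 928) 0 0 ∈ (evenFlag t).1 := Submodule.subset_span ⟨0, rfl⟩
  rw [h] at hmem
  obtain ⟨h₁, h₂, h₃⟩ := eq_of_mem_oddFlag hmem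
  have := (linearIndependent_evenFlag ht).ne_zero 0
  simp only [Matrix.cons_val_zero] at this
  refine this (eigVec_eq_zero.2 ⟨?_, ?_, ?_, rfl, rfl⟩)
  · rw [h₁]; ring
  · rw [h₂]; ring
  · rw [h₃]; ring

lemma not_conjStable5_evenFlag {t : ℂ} (ht : evenQuartic t = 0) :
    ¬ conjStable5 (evenFlag t).1 := by
  intro h
  have := h _ (mem_evenFlag t)
  simp only [conj_eigVec, map_zero, map_one] at this
  obtain ⟨x, rfl⟩ := Complex.conj_eq_iff_real.1 (eq_of_mem_evenFlag this)
  exact evenQuartic_ofReal_ne_zero x ht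

lemma not_conjStable5_oddFlag {ξ μ : ℂ} (h : (ξ, μ) ∈ oddParams) :
    ¬ conjStable5 (oddFlag ξ μ).1 := by
  intro hc
  obtain ⟨hξ, hμ⟩ := h
  simp only at hξ hμ
  have h0 := hc _ (mem_oddFlag_left ξ μ)
  have h1 := hc _ (mem_oddFlag_right ξ μ)
  rw [conj_eigVec, map_zero, map_one] at h0 h1
  obtain ⟨-, hQ₀, hR₀⟩ := eq_of_mem_oddFlag h0
  obtain ⟨-, hQ₁, hR₁⟩ := eq_of_mem_oddFlag h1
  simp only [one_mul, zero_mul, add_zero, zero_add] at hQ₀ hR₀ hQ₁ hR₁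
  have hξ' : ξ = μ * oddQ₀ ξ * (μ * oddR₁ ξ) - μ * oddQ₁ ξ * (μ * oddR₀ ξ) + 8 := by
    linear_combination -hμ
  have hreal : (starRingEnd ℂ) ξ = ξ := by
    have := congrArg (starRingEnd ℂ) hξ'
    rwa [map_add, map_sub, map_mul _ (μ * _) (μ * _), map_mul _ (μ * _) (μ * _), hQ₀, hR₀, hQ₁,
      hR₁, Complex.conj_ofNat, ← hξ'] at this
  obtain ⟨x, rfl⟩ := Complex.conj_eq_iff_real.1 hreal
  exact oddQuartic_ofReal_ne_zero x hξ

lemma setOf_isSchubertFlag : {P | IsSchubertFlag P} =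
    (fun z : ℂ × ℂ => oddFlag z.1 z.2) '' oddParams ∪ evenFlag '' {t | evenQuartic t = 0} := by
  ext P
  constructor
  · intro hP
    by_cases h : ∀ a₁ a₂ a₃, eigVec a₁ a₂ a₃ 0 0 ∈ P.1 → eigVec a₁ a₂ a₃ 0 0 = 0
    · obtain ⟨ξ, μ, hz, rfl⟩ := exists_eq_oddFlag hP h
      exact .inl ⟨(ξ, μ), hz, rfl⟩
    · push Not at h
      obtain ⟨a₁, a₂, a₃, ha, ha0⟩ := h
      obtain ⟨t, ht, rfl⟩ := exists_eq_evenFlag hP ha ha0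
      exact .inr ⟨t, ht, rfl⟩
  · rintro (⟨⟨ξ, μ⟩, ⟨hξ, hμ⟩, rfl⟩ | ⟨t, ht, rfl⟩)
    · exact isSchubertFlag_oddFlag hξ hμ
    · exact isSchubertFlag_evenFlag ht

lemma ncard_isSchubertFlag : {P | IsSchubertFlag P}.ncard = 12 := by
  have hdisj : Disjoint ((fun z : ℂ × ℂ => oddFlag z.1 z.2) '' oddParams)
      (evenFlag '' {t | evenQuartic t = 0}) := by
    rw [Set.disjoint_left]
    rintro _ ⟨z, -, rfl⟩ ⟨t, ht, h⟩
    exact evenFlag_ne_oddFlag ht h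
  rw [setOf_isSchubertFlag, Set.ncard_union_eq hdisj
    ((Set.finite_of_ncard_ne_zero (by simp [ncard_oddParams])).image _)
    ((Set.finite_of_ncard_ne_zero (by simp [ncard_evenQuartic])).image _),
    injOn_oddFlag.ncard_image, Set.ncard_image_of_injective _ injective_evenFlag,
    ncard_oddParams, ncard_evenQuartic]

/-- Example 2.1 (counterexample to the Shapiro–Shapiro conjecture for flag manifolds):
the set of flags `E₂ ⊂ E₃` in `ℂ⁵` with `E₂ ∩ F₃(s) ≠ 0` for `s ∈ {−8,−2,1,4}` and
`E₃ ∩ F₂(s) ≠ 0` for `s ∈ {−4,−1,2,8}` has exactly twelve elements, none of them real. -/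
theorem stmt_6 :
    {p : Submodule ℂ (Fin 5 → ℂ) × Submodule ℂ (Fin 5 → ℂ) |
        Module.finrank ℂ p.1 = 2 ∧ Module.finrank ℂ p.2 = 3 ∧ p.1 ≤ p.2 ∧
        (∀ s ∈ ({-8, -2, 1, 4} : Set ℂ), p.1 ⊓ oscF5 3 s ≠ ⊥) ∧
        (∀ s ∈ ({-4, -1, 2, 8} : Set ℂ), p.2 ⊓ oscF5 2 s ≠ ⊥)}.Finite ∧
      {p : Submodule ℂ (Fin 5 → ℂ) × Submodule ℂ (Fin 5 → ℂ) |
        Module.finrank ℂ p.1 = 2 ∧ Module.finrank ℂ p.2 = 3 ∧ p.1 ≤ p.2 ∧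
        (∀ s ∈ ({-8, -2, 1, 4} : Set ℂ), p.1 ⊓ oscF5 3 s ≠ ⊥) ∧
        (∀ s ∈ ({-4, -1, 2, 8} : Set ℂ), p.2 ⊓ oscF5 2 s ≠ ⊥)}.ncard = 12 ∧
      ∀ p ∈ {p : Submodule ℂ (Fin 5 → ℂ) × Submodule ℂ (Fin 5 → ℂ) |
        Module.finrank ℂ p.1 = 2 ∧ Module.finrank ℂ p.2 = 3 ∧ p.1 ≤ p.2 ∧
        (∀ s ∈ ({-8, -2, 1, 4} : Set ℂ), p.1 ⊓ oscF5 3 s ≠ ⊥) ∧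
        (∀ s ∈ ({-4, -1, 2, 8} : Set ℂ), p.2 ⊓ oscF5 2 s ≠ ⊥)},
        ¬ (conjStable5 p.1 ∧ conjStable5 p.2) := by
  refine ⟨Set.finite_of_ncard_ne_zero ?_, ncard_isSchubertFlag, ?_⟩
  · exact ncard_isSchubertFlag.trans_ne (by norm_num)
  · intro P hP hreal
    have hP' : P ∈ {P | IsSchubertFlag P} := hP
    rw [setOf_isSchubertFlag] at hP'
    rcases hP' with ⟨z, hz, rfl⟩ | ⟨t, ht, rfl⟩
    · exact not_conjStable5_oddFlag hz hreal.1
    · exact not_conjStable5_evenFlag ht hreal.1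
end

section
/- Let n = 3. For any six pairwise distinct real numbers s_1, …, s_6, the set of 3-dimensional maximal isotropic subspaces H ⊆ ℂ^7 (for the symmetric form B(x,y) = Σ_{i=1}^{7} x_i y_{8−i}) satisfying H ∩ F_4(s_j) ≠ {0} for j = 1, …, 6 has exactly two elements, and both are real, i.e., stable under coordinatewise complex conjugation. -/
/-- The `i`-th coordinate function of the curve `γ : ℂ → ℂ^{2n+1}`,
`γ(s)_i = (−1)^{max(i−n−1,0)} s^{i−1}/(i−1)!` (0-indexed `i`). -/
noncomputable def gammaOC (n : ℕ) (i : Fin (2 * n + 1)) : ℂ → ℂ :=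
  fun s => (-1 : ℂ) ^ ((i : ℕ) - n) * s ^ (i : ℕ) / (Nat.factorial (i : ℕ))

/-- The index pairing `i ↦ 2n+2−i` (1-indexed), i.e. `i ↦ 2n−i` (0-indexed). -/
def pairOC (n : ℕ) (i : Fin (2 * n + 1)) : Fin (2 * n + 1) :=
  ⟨2 * n - (i : ℕ), by omega⟩

/-- The symmetric bilinear form `B(x,y) = Σ_{i=1}^{2n+1} x_i y_{2n+2−i}` on `ℂ^{2n+1}`. -/
noncomputable def formOC (n : ℕ) (x y : Fin (2 * n + 1) → ℂ) : ℂ :=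
  ∑ i, x i * y (pairOC n i)

/-- The osculating subspace `F_k(s) = span{γ(s), γ'(s), …, γ^{(k-1)}(s)}`,
derivatives taken coordinatewise. -/
noncomputable def oscOC (n k : ℕ) (s : ℂ) : Submodule ℂ (Fin (2 * n + 1) → ℂ) :=
  Submodule.span ℂ (Set.range fun j : Fin k => fun i => iteratedDeriv (j : ℕ) (gammaOC n i) s)

/-- A subspace of `ℂ^N` is real if it is stable under coordinatewise complex conjugation. -/
def conjStableOC (n : ℕ) (H : Submodule ℂ (Fin (2 * n + 1) → ℂ)) : Prop :=
  ∀ x ∈ H, (fun i => (starRingEnd ℂ) (x i)) ∈ H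

/-- Clifford multiplication of a vector of `ℂ⁷` on an `8`-dimensional spinor
`z = (a; p₁, p₂, p₃; r₁, r₂, r₃; b)`. -/
def cliffordMul (v : Fin (2 * 3 + 1) → ℂ) (z : Fin 8 → ℂ) : Fin 8 → ℂ :=
  ![v 3 * z 0 + 2 * (v 0 * z 1 + v 1 * z 2 + v 2 * z 3),
    z 0 * v 6 - v 3 * z 1 + 2 * (z 5 * v 2 - z 6 * v 1),
    z 0 * v 5 - v 3 * z 2 + 2 * (z 6 * v 0 - z 4 * v 2),
    z 0 * v 4 - v 3 * z 3 + 2 * (z 4 * v 1 - z 5 * v 0),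
    v 5 * z 3 - v 4 * z 2 + v 3 * z 4 + 2 * z 7 * v 0,
    v 4 * z 1 - v 6 * z 3 + v 3 * z 5 + 2 * z 7 * v 1,
    v 6 * z 2 - v 5 * z 1 + v 3 * z 6 + 2 * z 7 * v 2,
    v 6 * z 4 + v 5 * z 5 + v 4 * z 6 - v 3 * z 7]

/-- The invariant quadratic form on spinors. -/
def spinorForm (z : Fin 8 → ℂ) : ℂ := z 0 * z 7 - z 1 * z 4 - z 2 * z 5 - z 3 * z 6

theorem formOC_three (x y : Fin (2 * 3 + 1) → ℂ) :
    formOC 3 x y = x 0 * y 6 + x 1 * y 5 + x 2 * y 4 + x 3 * y 3 + x 4 * y 2 + x 5 * y 1 +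
      x 6 * y 0 := by
  rw [formOC, Fin.sum_univ_seven]
  rfl

theorem cliffordMul_add_left (v w : Fin (2 * 3 + 1) → ℂ) (z : Fin 8 → ℂ) :
    cliffordMul (v + w) z = cliffordMul v z + cliffordMul w z := by
  ext i
  fin_cases i <;> simp [cliffordMul] <;> ring

theorem cliffordMul_smul_left (c : ℂ) (v : Fin (2 * 3 + 1) → ℂ) (z : Fin 8 → ℂ) :
    cliffordMul (c • v) z = c • cliffordMul v z := by
  ext i
  fin_cases i <;> simp [cliffordMul] <;> ring

theorem cliffordMul_smul_right (c : ℂ) (v : Fin (2 * 3 + 1) → ℂ) (z : Fin 8 → ℂ) :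
    cliffordMul v (c • z) = c • cliffordMul v z := by
  ext i
  fin_cases i <;> simp [cliffordMul] <;> ring

theorem cliffordMul_neg_right (v : Fin (2 * 3 + 1) → ℂ) (z : Fin 8 → ℂ) :
    cliffordMul v (-z) = -cliffordMul v z := by
  simpa using cliffordMul_smul_right (-1) v z

theorem cliffordMul_zero_right (v : Fin (2 * 3 + 1) → ℂ) : cliffordMul v 0 = 0 := by
  simpa using cliffordMul_smul_right 0 v 0

theorem cliffordMul_anticomm (v w : Fin (2 * 3 + 1) → ℂ) (z : Fin 8 → ℂ) :
    cliffordMul v (cliffordMul w z) =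
      (2 * formOC 3 v w) • z - cliffordMul w (cliffordMul v z) := by
  ext i
  rw [formOC_three]
  fin_cases i <;> simp [cliffordMul] <;> ring

theorem cliffordMul_self (v : Fin (2 * 3 + 1) → ℂ) (z : Fin 8 → ℂ) :
    cliffordMul v (cliffordMul v z) = formOC 3 v v • z := by
  ext i
  rw [formOC_three]
  fin_cases i <;> simp [cliffordMul] <;> ring

theorem spinorForm_cliffordMul (v : Fin (2 * 3 + 1) → ℂ) (z : Fin 8 → ℂ) :
    spinorForm (cliffordMul v z) = -(formOC 3 v v * spinorForm z) := by
  rw [formOC_three]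
  simp [cliffordMul, spinorForm]
  ring

/-- The vectors annihilating a spinor under Clifford multiplication. -/
def spinorAnnihilator (z : Fin 8 → ℂ) : Submodule ℂ (Fin (2 * 3 + 1) → ℂ) where
  carrier := {v | cliffordMul v z = 0}
  add_mem' {v w} hv hw := by
    simp only [Set.mem_ofPred_eq] at hv hw ⊢
    rw [cliffordMul_add_left, hv, hw, add_zero]
  zero_mem' := by simpa using cliffordMul_smul_left 0 0 z
  smul_mem' c v hv := by
    simp only [Set.mem_ofPred_eq] at hv ⊢
    rw [cliffordMul_smul_left, hv, smul_zero]

theorem mem_spinorAnnihilator {z : Fin 8 → ℂ} {v : Fin (2 * 3 + 1) → ℂ} :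
    v ∈ spinorAnnihilator z ↔ cliffordMul v z = 0 := Iff.rfl

/-- Linearly independent vectors have a dual family for the form. -/
theorem exists_dual_family {v : Fin 3 → Fin (2 * 3 + 1) → ℂ} (hv : LinearIndependent ℂ v)
    (i : Fin 3) : ∃ w, ∀ j, formOC 3 w (v j) = if j = i then 1 else 0 := by
  obtain ⟨φ, hφ⟩ := LinearMap.exists_extend ((Module.Basis.span hv).coord i)
  refine ⟨fun k => φ (Pi.single (pairOC 3 k) 1), fun j => ?_⟩
  have h1 : φ (v j) = if j = i then 1 else 0 := by
    have h2 := LinearMap.congr_fun hφ (Module.Basis.span hv j)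
    rw [LinearMap.comp_apply, Submodule.subtype_apply, Module.Basis.coord_apply,
      Module.Basis.repr_self, Finsupp.single_apply] at h2
    rw [← h2, Module.Basis.span_apply]
  rw [← h1, formOC_three, LinearMap.pi_apply_eq_sum_univ φ (v j), Fin.sum_univ_seven]
  simp only [smul_eq_mul]
  have hs : ∀ k : Fin (2 * 3 + 1), (fun l => if k = l then (1 : ℂ) else 0) = Pi.single k 1 := by
    intro k
    ext l
    simp [Pi.single_apply, eq_comm]
  simp only [hs]
  rw [show pairOC 3 0 = 6 from rfl, show pairOC 3 1 = 5 from rfl, show pairOC 3 2 = 4 from rfl,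
    show pairOC 3 3 = 3 from rfl, show pairOC 3 4 = 2 from rfl, show pairOC 3 5 = 1 from rfl,
    show pairOC 3 6 = 0 from rfl]
  ring

/-- Every maximal isotropic subspace annihilates a nonzero null spinor. -/
theorem exists_spinor {H : Submodule ℂ (Fin (2 * 3 + 1) → ℂ)} (hd : Module.finrank ℂ H = 3)
    (hi : ∀ x ∈ H, ∀ y ∈ H, formOC 3 x y = 0) :
    ∃ z, z ≠ 0 ∧ H ≤ spinorAnnihilator z ∧ spinorForm z = 0 := by
  obtain ⟨b⟩ : Nonempty (Module.Basis (Fin 3) ℂ H) := ⟨Module.finBasisOfFinrankEq ℂ H hd⟩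
  set v : Fin 3 → Fin (2 * 3 + 1) → ℂ := fun i => (b i : Fin (2 * 3 + 1) → ℂ)
  have hli : LinearIndependent ℂ v :=
    b.linearIndependent.map' H.subtype (Submodule.ker_subtype H)
  have hvv (i j : Fin 3) : formOC 3 (v i) (v j) = 0 := hi _ (b i).2 _ (b j).2
  choose w hw using exists_dual_family hli
  have hsq (i : Fin 3) (z : Fin 8 → ℂ) : cliffordMul (v i) (cliffordMul (v i) z) = 0 := by
    rw [cliffordMul_self, hvv, zero_smul]
  have hcomm (i j : Fin 3) (z : Fin 8 → ℂ) :
      cliffordMul (v i) (cliffordMul (v j) z) = -cliffordMul (v j) (cliffordMul (v i) z) := by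
    rw [cliffordMul_anticomm, hvv, mul_zero, zero_smul, zero_sub]
  have hwcomm (i j : Fin 3) (hij : j ≠ i) (z : Fin 8 → ℂ) :
      cliffordMul (w i) (cliffordMul (v j) z) = -cliffordMul (v j) (cliffordMul (w i) z) := by
    rw [cliffordMul_anticomm, hw, if_neg hij, mul_zero, zero_smul, zero_sub]
  have hwself (i : Fin 3) (z : Fin 8 → ℂ) :
      cliffordMul (w i) (cliffordMul (v i) z) =
        (2 : ℂ) • z - cliffordMul (v i) (cliffordMul (w i) z) := by
    rw [cliffordMul_anticomm, hw, if_pos rfl, mul_one]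
  obtain ⟨η, hη⟩ : ∃ η, cliffordMul (v 0) (cliffordMul (v 1) (cliffordMul (v 2) η)) ≠ 0 := by
    by_contra! h
    have h12 (z : Fin 8 → ℂ) : cliffordMul (v 1) (cliffordMul (v 2) z) = 0 := by
      have h1 := hwself 0 (cliffordMul (v 1) (cliffordMul (v 2) z))
      rw [h, hwcomm 0 1 (by decide), hwcomm 0 2 (by decide)] at h1
      simp only [cliffordMul_neg_right, neg_neg, h, cliffordMul_zero_right, sub_zero] at h1
      exact (smul_eq_zero_iff_right two_ne_zero).1 h1.symm
    have h2 (z : Fin 8 → ℂ) : cliffordMul (v 2) z = 0 := by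
      have h1 := hwself 1 (cliffordMul (v 2) z)
      rw [h12, hwcomm 1 2 (by decide)] at h1
      simp only [cliffordMul_neg_right, h12, neg_zero, cliffordMul_zero_right, sub_zero] at h1
      exact (smul_eq_zero_iff_right two_ne_zero).1 h1.symm
    have h1 := hwself 2 1
    rw [h2, h2, cliffordMul_zero_right, sub_zero] at h1
    exact one_ne_zero ((smul_eq_zero_iff_right two_ne_zero).1 h1.symm)
  refine ⟨_, hη, ?_, ?_⟩
  · intro x hx
    have hspan : (⟨x, hx⟩ : H) ∈ Submodule.span ℂ (Set.range b) := by
      rw [b.span_eq]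
      trivial
    have hle : Submodule.span ℂ (Set.range b) ≤ (spinorAnnihilator (cliffordMul (v 0)
        (cliffordMul (v 1) (cliffordMul (v 2) η)))).comap H.subtype := by
      rw [Submodule.span_le]
      rintro _ ⟨i, rfl⟩
      change cliffordMul (v i) _ = 0
      fin_cases i
      · exact hsq 0 _
      · change cliffordMul (v 1) _ = 0
        rw [hcomm 1 0, hsq, cliffordMul_zero_right, neg_zero]
      · change cliffordMul (v 2) _ = 0
        rw [hcomm 2 0, hcomm 2 1, hsq, neg_eq_zero, cliffordMul_neg_right,
          cliffordMul_zero_right, cliffordMul_zero_right, neg_zero]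
    exact hle hspan
  · rw [spinorForm_cliffordMul, hvv, zero_mul, neg_zero]

/-- The vectors of the fourth osculating subspace, in coordinates. -/
theorem mem_oscOC_three_four {s : ℂ} {v : Fin (2 * 3 + 1) → ℂ} :
    v ∈ oscOC 3 4 s ↔ ∃ c : Fin 4 → ℂ,
      v 0 = c 0 ∧ v 1 = c 0 * s + c 1 ∧ v 2 = c 0 * (s ^ 2 / 2) + c 1 * s + c 2 ∧
      v 3 = c 0 * (s ^ 3 / 6) + c 1 * (s ^ 2 / 2) + c 2 * s + c 3 ∧
      v 4 = -(c 0 * (s ^ 4 / 24) + c 1 * (s ^ 3 / 6) + c 2 * (s ^ 2 / 2) + c 3 * s) ∧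
      v 5 = c 0 * (s ^ 5 / 120) + c 1 * (s ^ 4 / 24) + c 2 * (s ^ 3 / 6) + c 3 * (s ^ 2 / 2) ∧
      v 6 = -(c 0 * (s ^ 6 / 720) + c 1 * (s ^ 5 / 120) + c 2 * (s ^ 4 / 24) +
        c 3 * (s ^ 3 / 6)) := by
  have hder (m : ℕ) (i : Fin (2 * 3 + 1)) : iteratedDeriv m (gammaOC 3 i) s =
      (-1 : ℂ) ^ ((i : ℕ) - 3) / (Nat.factorial (i : ℕ)) *
        ((Nat.descFactorial i m : ℂ) * s ^ ((i : ℕ) - m)) := by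
    have : gammaOC 3 i = fun s => (-1 : ℂ) ^ ((i : ℕ) - 3) / (Nat.factorial (i : ℕ)) *
        s ^ (i : ℕ) := by
      ext s
      simp only [gammaOC]
      ring
    rw [this, iteratedDeriv_const_mul_field]
    simp
  rw [oscOC, Submodule.mem_span_range_iff_exists_fun]
  refine exists_congr fun c => ?_
  rw [Fin.sum_univ_four]
  constructor
  · rintro rfl
    refine ⟨?_, ?_, ?_, ?_, ?_, ?_, ?_⟩ <;>
      simp [hder, Nat.factorial, Nat.descFactorial, -mul_eq_mul_left_iff] <;> ring
  · rintro ⟨h0, h1, h2, h3, h4, h5, h6⟩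
    ext k
    fin_cases k
    · refine Eq.trans ?_ h0.symm
      simp [hder, Nat.factorial, Nat.descFactorial, -mul_eq_mul_left_iff]
    · refine Eq.trans ?_ h1.symm
      simp [hder, Nat.factorial, Nat.descFactorial, -mul_eq_mul_left_iff]
    · refine Eq.trans ?_ h2.symm
      simp [hder, Nat.factorial, Nat.descFactorial, -mul_eq_mul_left_iff]
      ring
    · refine Eq.trans ?_ h3.symm
      simp [hder, Nat.factorial, Nat.descFactorial, -mul_eq_mul_left_iff]
      ring
    · refine Eq.trans ?_ h4.symm
      simp [hder, Nat.factorial, Nat.descFactorial, -mul_eq_mul_left_iff]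
      ring
    · refine Eq.trans ?_ h5.symm
      simp [hder, Nat.factorial, Nat.descFactorial, -mul_eq_mul_left_iff]
      ring
    · refine Eq.trans ?_ h6.symm
      simp [hder, Nat.factorial, Nat.descFactorial, -mul_eq_mul_left_iff]
      ring

/-- The sextic polynomial attached to a spinor. -/
def spinorSextic (z : Fin 8 → ℂ) (s : ℂ) : ℂ :=
  z 0 * s ^ 6 + 12 * z 3 * s ^ 5 + 60 * z 2 * s ^ 4 + (240 * z 4 + 120 * z 1) * s ^ 3 -
    720 * z 5 * s ^ 2 + 1440 * z 6 * s + 2880 * z 7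

/-- An isotropic vector of `F₄(s)` annihilating `z` forces `s` to be a root of the sextic. -/
theorem spinorSextic_eq_zero {s : ℂ} {z : Fin 8 → ℂ} {v : Fin (2 * 3 + 1) → ℂ} (hv : v ≠ 0)
    (hvs : v ∈ oscOC 3 4 s) (hi : formOC 3 v v = 0) (hz : cliffordMul v z = 0) :
    spinorSextic z s = 0 := by
  obtain ⟨c, h0, h1, h2, h3, h4, h5, h6⟩ := mem_oscOC_three_four.1 hvs
  have hc3 : c 3 = 0 := by
    rw [formOC_three, h0, h1, h2, h3, h4, h5, h6] at hi
    have : c 3 ^ 2 = 0 := by linear_combination hi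
    exact pow_eq_zero_iff two_ne_zero |>.1 this
  simp only [hc3, zero_mul, add_zero] at h3 h4 h5 h6
  by_contra hF
  have e0 := congrFun hz 0
  have e1 := congrFun hz 1
  have e2 := congrFun hz 2
  have e3 := congrFun hz 3
  have e4 := congrFun hz 4
  have e5 := congrFun hz 5
  have e6 := congrFun hz 6
  simp [cliffordMul] at e0 e1 e2 e3 e4 e5 e6
  rw [h0, h1, h2, h3] at e0
  rw [h1, h2, h3, h6] at e1
  rw [h0, h2, h3, h5] at e2
  rw [h0, h1, h3, h4] at e3
  rw [h0, h3, h4, h5] at e4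
  rw [h1, h3, h4, h6] at e5
  rw [h2, h3, h5, h6] at e6
  have k0 : c 0 * spinorSextic z s = 0 := by
    rw [spinorSextic]
    linear_combination 1440 * (e4 + s / 2 * e2 + s ^ 2 / 4 * e3 + s ^ 3 / 24 * e0)
  have k1 : (c 0 * s + c 1) * spinorSextic z s = 0 := by
    rw [spinorSextic]
    linear_combination 1440 * (e5 - s / 2 * e1 + s ^ 3 / 12 * e3 + s ^ 4 / 48 * e0)
  have k2 : (c 0 * (s ^ 2 / 2) + c 1 * s + c 2) * spinorSextic z s = 0 := by
    rw [spinorSextic]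
    linear_combination 1440 * (e6 - s ^ 2 / 4 * e1 - s ^ 3 / 12 * e2 + s ^ 5 / 240 * e0)
  have c0 : c 0 = 0 := (mul_eq_zero.1 k0).resolve_right hF
  have c1 : c 1 = 0 := by simpa [c0] using (mul_eq_zero.1 k1).resolve_right hF
  have c2 : c 2 = 0 := by simpa [c0, c1] using (mul_eq_zero.1 k2).resolve_right hF
  simp only [c0, c1, c2, zero_mul, add_zero, neg_zero] at h0 h1 h2 h3 h4 h5 h6
  apply hv
  ext i
  fin_cases i <;> assumption

/-- The parametrization of the maximal isotropic subspace annihilating a null spinor `z` with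
`z 0 = 1` by its first three coordinates. -/
def graphMap (z : Fin 8 → ℂ) : (Fin 3 → ℂ) →ₗ[ℂ] (Fin (2 * 3 + 1) → ℂ) where
  toFun x := ![x 0, x 1, x 2, -2 * (x 0 * z 1 + x 1 * z 2 + x 2 * z 3),
    -2 * (x 0 * z 1 + x 1 * z 2 + x 2 * z 3) * z 3 - 2 * (z 4 * x 1 - z 5 * x 0),
    -2 * (x 0 * z 1 + x 1 * z 2 + x 2 * z 3) * z 2 - 2 * (z 6 * x 0 - z 4 * x 2),
    -2 * (x 0 * z 1 + x 1 * z 2 + x 2 * z 3) * z 1 - 2 * (z 5 * x 2 - z 6 * x 1)]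
  map_add' x y := by
    ext i
    fin_cases i <;> simp <;> ring
  map_smul' c x := by
    ext i
    fin_cases i <;> simp <;> ring

theorem graphMap_injective (z : Fin 8 → ℂ) : Function.Injective (graphMap z) := by
  intro x y h
  ext i
  fin_cases i
  · exact congrFun h 0
  · exact congrFun h 1
  · exact congrFun h 2

theorem finrank_range_graphMap (z : Fin 8 → ℂ) :
    Module.finrank ℂ (LinearMap.range (graphMap z)) = 3 := by
  rw [LinearMap.finrank_range_of_inj (graphMap_injective z), Module.finrank_fin_fun]

theorem formOC_graphMap (z : Fin 8 → ℂ) (x y : Fin 3 → ℂ) :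
    formOC 3 (graphMap z x) (graphMap z y) = 0 := by
  rw [formOC_three]
  simp [graphMap]
  ring

theorem spinorAnnihilator_le_range_graphMap {z : Fin 8 → ℂ} (hz : z 0 = 1) :
    spinorAnnihilator z ≤ LinearMap.range (graphMap z) := by
  intro v hv
  rw [mem_spinorAnnihilator] at hv
  have e0 := congrFun hv 0
  have e1 := congrFun hv 1
  have e2 := congrFun hv 2
  have e3 := congrFun hv 3
  simp [cliffordMul, hz] at e0 e1 e2 e3
  refine ⟨![v 0, v 1, v 2], ?_⟩
  ext i
  fin_cases i <;> simp [graphMap]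
  · linear_combination -e0
  · linear_combination -e3 - z 3 * e0
  · linear_combination -e2 - z 2 * e0
  · linear_combination -e1 - z 1 * e0

theorem range_graphMap_ne {z w : Fin 8 → ℂ} (h : z 1 ≠ w 1) :
    LinearMap.range (graphMap z) ≠ LinearMap.range (graphMap w) := by
  intro he
  have hm : graphMap z ![1, 0, 0] ∈ LinearMap.range (graphMap w) := he ▸ ⟨_, rfl⟩
  obtain ⟨x, hx⟩ := hm
  have e0 := congrFun hx 0
  have e1 := congrFun hx 1
  have e2 := congrFun hx 2
  have e3 := congrFun hx 3
  simp [graphMap] at e0 e1 e2 e3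
  rw [e0, e1, e2] at e3
  apply h
  linear_combination -e3

theorem conjStableOC_range_graphMap {z : Fin 8 → ℂ} (hz : ∀ i, (starRingEnd ℂ) (z i) = z i) :
    conjStableOC 3 (LinearMap.range (graphMap z)) := by
  rintro _ ⟨x, rfl⟩
  refine ⟨fun i => (starRingEnd ℂ) (x i), ?_⟩
  ext i
  fin_cases i <;> simp [graphMap, hz, Complex.conj_ofNat]

/-- At a simple root `s` of the sextic of a null spinor, the associated maximal isotropic
subspace meets `F₄(s)`. -/
theorem range_graphMap_inf_oscOC_ne_bot {z : Fin 8 → ℂ} {s : ℂ} (hz : z 0 = 1)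
    (hq : spinorForm z = 0) (hF : spinorSextic z s = 0)
    (hF' : 6 * z 0 * s ^ 5 + 60 * z 3 * s ^ 4 + 240 * z 2 * s ^ 3 +
      3 * (240 * z 4 + 120 * z 1) * s ^ 2 - 1440 * z 5 * s + 1440 * z 6 ≠ 0) :
    LinearMap.range (graphMap z) ⊓ oscOC 3 4 s ≠ ⊥ := by
  rw [Submodule.ne_bot_iff]
  rw [spinorForm, hz] at hq
  rw [spinorSextic, hz] at hF
  set k0 := z 4 + s ^ 3 / 24 + z 2 * s / 2 + z 3 * s ^ 2 / 4 with hk0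
  set k1 := z 5 + s ^ 4 / 48 + z 3 * s ^ 3 / 12 - z 1 * s / 2 with hk1
  set k2 := z 6 + s ^ 5 / 240 - z 1 * s ^ 2 / 4 - z 2 * s ^ 3 / 12 with hk2
  refine ⟨graphMap z ![k0, k1, k2], ⟨⟨_, rfl⟩, ?_⟩, ?_⟩
  · refine mem_oscOC_three_four.2
      ⟨![k0, k1 - s * k0, k2 - s * k1 + s ^ 2 / 2 * k0, 0], ?_⟩
    refine ⟨?_, ?_, ?_, ?_, ?_, ?_, ?_⟩ <;> simp [graphMap]
    · ring
    · ring
    · rw [hk0, hk1, hk2]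
      linear_combination -hF / 1440 + 2 * hq
    · rw [hk0, hk1, hk2]
      linear_combination (-hF / 1440 + 2 * hq) * (z 3 - s / 2)
    · rw [hk0, hk1, hk2]
      linear_combination (-hF / 1440 + 2 * hq) * (z 2 + s ^ 2 / 4)
    · rw [hk0, hk1, hk2]
      linear_combination (-hF / 1440 + 2 * hq) * (z 1 - s ^ 3 / 12)
  · intro h
    have e0 : k0 = 0 := congrFun h 0
    have e1 : k1 = 0 := congrFun h 1
    have e2 : k2 = 0 := congrFun h 2
    apply hF'
    rw [hz]
    linear_combination 1440 * (e2 - s * e1 + s ^ 2 / 2 * e0)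

/-- The quadratic invariant of a sextic is a sum of squares over the perfect matchings of its
roots. -/
theorem sextic_invariant_eq_sum_sq (a b c d f g e₁ e₂ e₃ e₄ e₅ e₆ : ℝ)
    (h₁ : e₁ = a + b + c + d + f + g)
    (h₂ : e₂ = a * b + a * c + a * d + a * f + a * g + b * c + b * d + b * f + b * g + c * d +
      c * f + c * g + d * f + d * g + f * g)
    (h₃ : e₃ = a * b * c + a * b * d + a * b * f + a * b * g + a * c * d + a * c * f + a * c * g +
      a * d * f + a * d * g + a * f * g + b * c * d + b * c * f + b * c * g + b * d * f +
      b * d * g + b * f * g + c * d * f + c * d * g + c * f * g + d * f * g)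
    (h₄ : e₄ = a * b * c * d + a * b * c * f + a * b * c * g + a * b * d * f + a * b * d * g +
      a * b * f * g + a * c * d * f + a * c * d * g + a * c * f * g + a * d * f * g +
      b * c * d * f + b * c * d * g + b * c * f * g + b * d * f * g + c * d * f * g)
    (h₅ : e₅ = a * b * c * d * f + a * b * c * d * g + a * b * c * f * g + a * b * d * f * g +
      a * c * d * f * g + b * c * d * f * g)
    (h₆ : e₆ = a * b * c * d * f * g) :
    2 * (3 * e₃ ^ 2 - 8 * e₂ * e₄ + 20 * e₁ * e₅ - 120 * e₆) =
      ((a - b) * (c - d) * (f - g)) ^ 2 +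
      ((a - b) * (c - f) * (d - g)) ^ 2 +
      ((a - b) * (c - g) * (d - f)) ^ 2 +
      ((a - c) * (b - d) * (f - g)) ^ 2 +
      ((a - c) * (b - f) * (d - g)) ^ 2 +
      ((a - c) * (b - g) * (d - f)) ^ 2 +
      ((a - d) * (b - c) * (f - g)) ^ 2 +
      ((a - d) * (b - f) * (c - g)) ^ 2 +
      ((a - d) * (b - g) * (c - f)) ^ 2 +
      ((a - f) * (b - c) * (d - g)) ^ 2 +
      ((a - f) * (b - d) * (c - g)) ^ 2 +
      ((a - f) * (b - g) * (c - d)) ^ 2 +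
      ((a - g) * (b - c) * (d - f)) ^ 2 +
      ((a - g) * (b - d) * (c - f)) ^ 2 +
      ((a - g) * (b - f) * (c - d)) ^ 2 := by
  subst h₁ h₂ h₃ h₄ h₅ h₆
  ring

/-- The coefficients of a real sextic with six distinct real roots: the roots are simple and the
quadratic invariant of the sextic is positive. -/
theorem exists_sextic_coeff {x : Fin 6 → ℝ} (hx : Function.Injective x) :
    ∃ e : Fin 6 → ℝ,
      (∀ j, x j ^ 6 - e 0 * x j ^ 5 + e 1 * x j ^ 4 - e 2 * x j ^ 3 + e 3 * x j ^ 2 -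
        e 4 * x j + e 5 = 0) ∧
      (∀ j, 6 * x j ^ 5 - 5 * e 0 * x j ^ 4 + 4 * e 1 * x j ^ 3 - 3 * e 2 * x j ^ 2 +
        2 * e 3 * x j - e 4 ≠ 0) ∧
      0 < 3 * e 2 ^ 2 - 8 * e 1 * e 3 + 20 * e 0 * e 4 - 120 * e 5 := by
  have hne {i j : Fin 6} (h : i ≠ j) : x i - x j ≠ 0 := sub_ne_zero.2 (hx.ne h)
  have h01 := hne (show (0 : Fin 6) ≠ 1 by decide)
  have h23 := hne (show (2 : Fin 6) ≠ 3 by decide)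
  have h45 := hne (show (4 : Fin 6) ≠ 5 by decide)
  have hroot (j : Fin 6) : ∏ i, (if i = j then 1 else x j - x i) ≠ 0 := by
    refine Finset.prod_ne_zero_iff.2 fun i _ => ?_
    split_ifs with h
    · exact one_ne_zero
    · exact hne (Ne.symm h)
  generalize hx0 : x 0 = a at *
  generalize hx1 : x 1 = b at *
  generalize hx2 : x 2 = c at *
  generalize hx3 : x 3 = d at *
  generalize hx4 : x 4 = f at *
  generalize hx5 : x 5 = g at *
  refine ⟨![a + b + c + d + f + g,
    a * b + a * c + a * d + a * f + a * g + b * c + b * d + b * f + b * g + c * d +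
      c * f + c * g + d * f + d * g + f * g,
    a * b * c + a * b * d + a * b * f + a * b * g + a * c * d + a * c * f + a * c * g +
      a * d * f + a * d * g + a * f * g + b * c * d + b * c * f + b * c * g + b * d * f +
      b * d * g + b * f * g + c * d * f + c * d * g + c * f * g + d * f * g,
    a * b * c * d + a * b * c * f + a * b * c * g + a * b * d * f + a * b * d * g +
      a * b * f * g + a * c * d * f + a * c * d * g + a * c * f * g + a * d * f * g +
      b * c * d * f + b * c * d * g + b * c * f * g + b * d * f * g + c * d * f * g,
    a * b * c * d * f + a * b * c * d * g + a * b * c * f * g + a * b * d * f * g +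
      a * c * d * f * g + b * c * d * f * g,
    a * b * c * d * f * g], ?_, ?_, ?_⟩
  · intro j
    fin_cases j <;> simp [hx0, hx1, hx2, hx3, hx4, hx5] <;> ring
  · intro j h
    refine hroot j (Eq.trans ?_ h)
    rw [Fin.prod_univ_six]
    fin_cases j <;> simp [hx0, hx1, hx2, hx3, hx4, hx5] <;> ring
  · have hpos : 0 < ((a - b) * (c - d) * (f - g)) ^ 2 := by positivity
    have key := sextic_invariant_eq_sum_sq a b c d f g _ _ _ _ _ _ rfl rfl rfl rfl rfl rfl
    refine pos_of_mul_pos_right (a := (2 : ℝ)) (lt_of_lt_of_eq ?_ key.symm) zero_le_two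
    positivity

/-- The spinor with `z 0 = 1`, sextic `t⁶ - e₁t⁵ + ⋯ + e₆` and remaining coordinate `c`. -/
noncomputable def sexticSpinor (e : Fin 6 → ℝ) (c : ℝ) : Fin 8 → ℂ :=
  ![1, -e 2 / 240 + c, e 1 / 60, -e 0 / 12, (-e 2 / 240 - c) / 2, -e 3 / 720, -e 4 / 1440,
    e 5 / 2880]

theorem conj_sexticSpinor (e : Fin 6 → ℝ) (c : ℝ) (i : Fin 8) :
    (starRingEnd ℂ) (sexticSpinor e c i) = sexticSpinor e c i := by
  fin_cases i <;> simp [sexticSpinor, Complex.conj_ofNat]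

theorem spinorForm_sexticSpinor {e : Fin 6 → ℝ} {c : ℝ}
    (hc : c ^ 2 = (3 * e 2 ^ 2 - 8 * e 1 * e 3 + 20 * e 0 * e 4 - 120 * e 5) / 172800) :
    spinorForm (sexticSpinor e c) = 0 := by
  have hc' : (c : ℂ) ^ 2 =
      (3 * e 2 ^ 2 - 8 * e 1 * e 3 + 20 * e 0 * e 4 - 120 * e 5) / 172800 := by
    exact_mod_cast hc
  simp [spinorForm, sexticSpinor]
  linear_combination hc' / 2

theorem spinorSextic_sexticSpinor (e : Fin 6 → ℝ) (c : ℝ) (t : ℂ) :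
    spinorSextic (sexticSpinor e c) t =
      t ^ 6 - e 0 * t ^ 5 + e 1 * t ^ 4 - e 2 * t ^ 3 + e 3 * t ^ 2 - e 4 * t + e 5 := by
  simp [spinorSextic, sexticSpinor]
  ring

/-- A nonzero null spinor whose sextic has six prescribed roots is determined up to scale and
sign of one coordinate. -/
theorem exists_eq_smul_sexticSpinor {x : Fin 6 → ℝ} (hx : Function.Injective x)
    {e : Fin 6 → ℝ} {c : ℝ}
    (he : ∀ j, x j ^ 6 - e 0 * x j ^ 5 + e 1 * x j ^ 4 - e 2 * x j ^ 3 + e 3 * x j ^ 2 -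
        e 4 * x j + e 5 = 0)
    (hc : c ^ 2 = (3 * e 2 ^ 2 - 8 * e 1 * e 3 + 20 * e 0 * e 4 - 120 * e 5) / 172800)
    {z : Fin 8 → ℂ} (hz : z ≠ 0) (hq : spinorForm z = 0)
    (hF : ∀ j, spinorSextic z (x j) = 0) :
    ∃ a : ℂ, a ≠ 0 ∧ (z = a • sexticSpinor e c ∨ z = a • sexticSpinor e (-c)) := by
  have hcoef : (![2880 * z 7 - z 0 * e 5, 1440 * z 6 + z 0 * e 4, -720 * z 5 - z 0 * e 3,
      240 * z 4 + 120 * z 1 + z 0 * e 2, 60 * z 2 - z 0 * e 1, 12 * z 3 + z 0 * e 0] :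
      Fin 6 → ℂ) = 0 := by
    refine Matrix.eq_zero_of_forall_index_sum_pow_mul_eq_zero (f := fun j => (x j : ℂ))
      (fun i j h => hx (Complex.ofReal_injective h)) fun j => ?_
    have h1 : (x j : ℂ) ^ 6 - e 0 * x j ^ 5 + e 1 * x j ^ 4 - e 2 * x j ^ 3 + e 3 * x j ^ 2 -
        e 4 * x j + e 5 = 0 := by exact_mod_cast he j
    have h2 := hF j
    rw [spinorSextic] at h2
    simp [Fin.sum_univ_six]
    linear_combination h2 - z 0 * h1
  have h7 := congrFun hcoef 0
  have h6 := congrFun hcoef 1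
  have h5 := congrFun hcoef 2
  have h4 := congrFun hcoef 3
  have h2 := congrFun hcoef 4
  have h3 := congrFun hcoef 5
  simp at h7 h6 h5 h4 h2 h3
  have e7 : z 7 = z 0 * (e 5 / 2880) := by linear_combination h7 / 2880
  have e6 : z 6 = z 0 * (-e 4 / 1440) := by linear_combination h6 / 1440
  have e5 : z 5 = z 0 * (-e 3 / 720) := by linear_combination -h5 / 720
  have e4 : z 4 = (-z 0 * e 2 / 120 - z 1) / 2 := by linear_combination h4 / 240
  have e3 : z 3 = z 0 * (-e 0 / 12) := by linear_combination h3 / 12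
  have e2 : z 2 = z 0 * (e 1 / 60) := by linear_combination h2 / 60
  have hc' : (c : ℂ) ^ 2 =
      (3 * e 2 ^ 2 - 8 * e 1 * e 3 + 20 * e 0 * e 4 - 120 * e 5) / 172800 := by
    exact_mod_cast hc
  have hsq : (z 1 + z 0 * e 2 / 240) ^ 2 = (z 0 * c) ^ 2 := by
    rw [spinorForm, e7, e6, e5, e4, e3, e2] at hq
    rw [mul_pow, hc']
    linear_combination 2 * hq
  have hext (c' : ℝ) (h : z 1 + z 0 * e 2 / 240 = z 0 * c') : z = z 0 • sexticSpinor e c' := by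
    have e1 : z 1 = z 0 * (-e 2 / 240 + c') := by linear_combination h
    ext i
    fin_cases i <;> simp [sexticSpinor]
    · exact e1
    · exact e2
    · exact e3
    · rw [e4]
      linear_combination -h / 2
    · exact e5
    · exact e6
    · exact e7
  have hor : z = z 0 • sexticSpinor e c ∨ z = z 0 • sexticSpinor e (-c) := by
    rcases sq_eq_sq_iff_eq_or_eq_neg.1 hsq with h | h
    · exact Or.inl (hext c h)
    · refine Or.inr (hext (-c) ?_)
      push_cast
      linear_combination h
  refine ⟨z 0, fun h0 => hz ?_, hor⟩
  rcases hor with h | h <;> rw [h, h0, zero_smul]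

/-- The two-point description of the solution set. -/
theorem isotropic_osculating_solutions {x : Fin 6 → ℝ} (hx : Function.Injective x)
    {e : Fin 6 → ℝ} {c : ℝ}
    (he : ∀ j, x j ^ 6 - e 0 * x j ^ 5 + e 1 * x j ^ 4 - e 2 * x j ^ 3 + e 3 * x j ^ 2 -
        e 4 * x j + e 5 = 0)
    (he' : ∀ j, 6 * x j ^ 5 - 5 * e 0 * x j ^ 4 + 4 * e 1 * x j ^ 3 - 3 * e 2 * x j ^ 2 +
        2 * e 3 * x j - e 4 ≠ 0)
    (hc : c ^ 2 = (3 * e 2 ^ 2 - 8 * e 1 * e 3 + 20 * e 0 * e 4 - 120 * e 5) / 172800) :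
    {H : Submodule ℂ (Fin (2 * 3 + 1) → ℂ) |
        Module.finrank ℂ H = 3 ∧
        (∀ x ∈ H, ∀ y ∈ H, formOC 3 x y = 0) ∧
        ∀ j : Fin 6, H ⊓ oscOC 3 4 ((x j : ℝ) : ℂ) ≠ ⊥} =
      {LinearMap.range (graphMap (sexticSpinor e c)),
        LinearMap.range (graphMap (sexticSpinor e (-c)))} := by
  have hmem (c' : ℝ)
      (hc' : c' ^ 2 = (3 * e 2 ^ 2 - 8 * e 1 * e 3 + 20 * e 0 * e 4 - 120 * e 5) / 172800)
      (j : Fin 6) :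
      LinearMap.range (graphMap (sexticSpinor e c')) ⊓ oscOC 3 4 ((x j : ℝ) : ℂ) ≠ ⊥ := by
    refine range_graphMap_inf_oscOC_ne_bot rfl (spinorForm_sexticSpinor hc') ?_ ?_
    · rw [spinorSextic_sexticSpinor]
      exact_mod_cast he j
    · have h1 : ((6 * x j ^ 5 - 5 * e 0 * x j ^ 4 + 4 * e 1 * x j ^ 3 - 3 * e 2 * x j ^ 2 +
        2 * e 3 * x j - e 4 : ℝ) : ℂ) ≠ 0 := Complex.ofReal_ne_zero.2 (he' j)
      convert h1 using 1
      simp [sexticSpinor]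
      ring
  ext H
  constructor
  · rintro ⟨hd, hi, hm⟩
    obtain ⟨z, hz, hHz, hq⟩ := exists_spinor hd hi
    have hF (j : Fin 6) : spinorSextic z (x j) = 0 := by
      obtain ⟨v, ⟨hvH, hvs⟩, hv⟩ := (Submodule.ne_bot_iff _).1 (hm j)
      exact spinorSextic_eq_zero hv hvs (hi v hvH v hvH) (hHz hvH)
    obtain ⟨a, ha, hor⟩ := exists_eq_smul_sexticSpinor hx he hc hz hq hF
    have heq (c' : ℝ) (h : z = a • sexticSpinor e c') :
        H = LinearMap.range (graphMap (sexticSpinor e c')) := by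
      refine Submodule.eq_of_le_of_finrank_eq (fun v hv => ?_)
        (hd.trans (finrank_range_graphMap _).symm)
      have h1 : cliffordMul v z = 0 := hHz hv
      rw [h, cliffordMul_smul_right] at h1
      exact spinorAnnihilator_le_range_graphMap rfl ((smul_eq_zero_iff_right ha).1 h1)
    exact hor.imp (heq c) (heq (-c))
  · rintro (rfl | rfl)
    · refine ⟨finrank_range_graphMap _, ?_, hmem c hc⟩
      rintro _ ⟨u, rfl⟩ _ ⟨w, rfl⟩
      exact formOC_graphMap _ u w
    · refine ⟨finrank_range_graphMap _, ?_, hmem (-c) (by rw [neg_sq, hc])⟩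
      rintro _ ⟨u, rfl⟩ _ ⟨w, rfl⟩
      exact formOC_graphMap _ u w

/-- For `n = 3` and any six pairwise distinct real numbers `s_1, …, s_6`, the set of
3-dimensional maximal isotropic subspaces `H ⊆ ℂ⁷` with `H ∩ F₄(s_j) ≠ 0` for all `j`
has exactly two elements, and both are real. -/
theorem stmt_8 (s : Fin 6 → ℝ) (hs : Function.Injective s) :
    {H : Submodule ℂ (Fin (2 * 3 + 1) → ℂ) |
        Module.finrank ℂ H = 3 ∧
        (∀ x ∈ H, ∀ y ∈ H, formOC 3 x y = 0) ∧
        ∀ j : Fin 6, H ⊓ oscOC 3 4 ((s j : ℝ) : ℂ) ≠ ⊥}.Finite ∧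
      {H : Submodule ℂ (Fin (2 * 3 + 1) → ℂ) |
        Module.finrank ℂ H = 3 ∧
        (∀ x ∈ H, ∀ y ∈ H, formOC 3 x y = 0) ∧
        ∀ j : Fin 6, H ⊓ oscOC 3 4 ((s j : ℝ) : ℂ) ≠ ⊥}.ncard = 2 ∧
      ∀ H ∈ {H : Submodule ℂ (Fin (2 * 3 + 1) → ℂ) |
        Module.finrank ℂ H = 3 ∧
        (∀ x ∈ H, ∀ y ∈ H, formOC 3 x y = 0) ∧
        ∀ j : Fin 6, H ⊓ oscOC 3 4 ((s j : ℝ) : ℂ) ≠ ⊥}, conjStableOC 3 H := by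
  obtain ⟨e, he, he', hpos⟩ := exists_sextic_coeff hs
  have hK := div_pos hpos (show (0 : ℝ) < 172800 by norm_num)
  have hc := Real.sq_sqrt hK.le
  have hc0 := Real.sqrt_pos.2 hK
  set c := √((3 * e 2 ^ 2 - 8 * e 1 * e 3 + 20 * e 0 * e 4 - 120 * e 5) / 172800)
  rw [isotropic_osculating_solutions hs he he' hc]
  refine ⟨Set.toFinite _, Set.ncard_pair (range_graphMap_ne fun h => ?_), ?_⟩
  · simp only [sexticSpinor, Matrix.cons_val_one, Matrix.cons_val_zero, add_right_inj,
      Complex.ofReal_inj] at h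
    linarith
  · rintro H (rfl | rfl) <;> exact conjStableOC_range_graphMap (conj_sexticSpinor e _)
end

section
/- For real numbers s_1, …, s_6, the sum over all permutations w of {1,…,6} of (s_{w(1)} − s_{w(2)})² (s_{w(3)} − s_{w(4)})² (s_{w(5)} − s_{w(6)})² equals zero if and only if four of the s_i coincide, i.e., there exist four pairwise distinct indices i, j, k, l ∈ {1,…,6} with s_i = s_j = s_k = s_l. -/
/-- The permutation of `Fin 6` carrying the consecutive pairs `{0, 1}`, `{2, 3}`, `{4, 5}` to the
pairs `{0, 3}`, `{1, 4}`, `{2, 5}`. -/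
def pairingPerm : Equiv.Perm (Fin 6) where
  toFun := ![0, 3, 1, 4, 2, 5]
  invFun := ![0, 2, 4, 1, 3, 5]
  left_inv := by decide
  right_inv := by decide

/-- If `s` takes the same value at four indices, then one of the three pairs
`{w 0, w 1}`, `{w 2, w 3}`, `{w 4, w 5}` contains two of them. -/
theorem pair_eq_of_card_eq_four {α : Type*} {s : Fin 6 → α} {c : α} {A : Finset (Fin 6)}
    (hA : A.card = 4) (hc : ∀ x ∈ A, s x = c) (w : Equiv.Perm (Fin 6)) :
    s (w 0) = s (w 1) ∨ s (w 2) = s (w 3) ∨ s (w 4) = s (w 5) := by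
  obtain ⟨x, hx, y, hy, hxy, h⟩ := Finset.exists_ne_map_eq_of_card_lt_of_maps_to
    (s := A) (t := Finset.range 3) (f := fun x => (w.symm x : ℕ) / 2) (by simp [hA])
    (fun x _ => by simp only [Finset.coe_range, Set.mem_Iio]; omega)
  obtain ⟨a, rfl⟩ := w.surjective x
  obtain ⟨b, rfl⟩ := w.surjective y
  have hs : s (w a) = s (w b) := (hc _ hx).trans (hc _ hy).symm
  have hab : a ≠ b := fun e => hxy (congrArg w e)
  simp only [Equiv.symm_apply_apply] at h
  clear hx hy hxy hc
  fin_cases a <;> fin_cases b <;> simp_all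

/-- The discriminant `Σ_{w ∈ S_6} (s_{w1}−s_{w2})²(s_{w3}−s_{w4})²(s_{w5}−s_{w6})²`
vanishes if and only if four of the `s_i` coincide. -/
theorem stmt_9 (s : Fin 6 → ℝ) :
    (∑ w : Equiv.Perm (Fin 6),
        (s (w 0) - s (w 1)) ^ 2 * (s (w 2) - s (w 3)) ^ 2 * (s (w 4) - s (w 5)) ^ 2) = 0 ↔
      ∃ i j k l : Fin 6, i ≠ j ∧ i ≠ k ∧ i ≠ l ∧ j ≠ k ∧ j ≠ l ∧ k ≠ l ∧
        s i = s j ∧ s j = s k ∧ s k = s l := by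
  rw [Finset.sum_eq_zero_iff_of_nonneg (fun _ _ => by positivity)]
  simp only [Finset.mem_univ, true_imp_iff, mul_eq_zero, pow_eq_zero_iff two_ne_zero, sub_eq_zero,
    or_assoc]
  constructor
  · intro h
    set σ := Tuple.sort s
    have mono : Monotone (s ∘ σ) := Tuple.monotone_sort s
    have four {a b c d : Fin 6} (hab : a < b) (hbc : b < c) (hcd : c < d)
        (had : s (σ a) = s (σ d)) :
        ∃ i j k l : Fin 6, i ≠ j ∧ i ≠ k ∧ i ≠ l ∧ j ≠ k ∧ j ≠ l ∧ k ≠ l ∧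
          s i = s j ∧ s j = s k ∧ s k = s l := by
      have h₁ : s (σ a) ≤ s (σ b) := mono hab.le
      have h₂ : s (σ b) ≤ s (σ c) := mono hbc.le
      have h₃ : s (σ c) ≤ s (σ d) := mono hcd.le
      refine ⟨σ a, σ b, σ c, σ d, σ.injective.ne hab.ne, σ.injective.ne (hab.trans hbc).ne,
        σ.injective.ne (hab.trans (hbc.trans hcd)).ne, σ.injective.ne hbc.ne,
        σ.injective.ne (hbc.trans hcd).ne, σ.injective.ne hcd.ne, ?_, ?_, ?_⟩ <;> linarith
    rcases h (pairingPerm.trans σ) with h | h | h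
    · exact four (a := 0) (b := 1) (c := 2) (d := 3) (by decide) (by decide) (by decide) h
    · exact four (a := 1) (b := 2) (c := 3) (d := 4) (by decide) (by decide) (by decide) h
    · exact four (a := 2) (b := 3) (c := 4) (d := 5) (by decide) (by decide) (by decide) h
  · rintro ⟨i, j, k, l, hij, hik, hil, hjk, hjl, hkl, h₁, h₂, h₃⟩
    refine pair_eq_of_card_eq_four (A := {i, j, k, l}) (c := s l) ?_ ?_
    · simp [hij, hik, hil, hjk, hjl, hkl]
    · simp [h₁, h₂, h₃]
end
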